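/- arXiv:2006.05973 — 4 statements merged into one kernel-verified Lean document; each statement's English description precedes it below -/
import Mathlib

section
/- Suppose there exists A ∈ F with A ≠ ∅ and A ≠ Ω. For w ≥ 0 let H(w) := inf_{λ∈ℝ} max( ψ*(λ + w/2), ψ*(λ − w/2) ) (the height-for-width function of ψ*). Then for every ε ≥ 0: inf{ D_φ(μ‖ν) : μ, ν probability measures on (Ω,F) with TV(μ,ν) = ε } = sup_{w≥0} ( w·ε/2 − H(w) ), with inf ∅ = +∞. (Solution of Vajda's problem: the optimal lower bound of the φ-divergence as a function of the total variation distance.) -/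
open MeasureTheory Filter Set
open scoped ENNReal NNReal Topology

/-- Map an extended real to `ℝ≥0∞`, sending `⊤` to `⊤` and negative values to `0`. -/
noncomputable def erealToENNReal (x : EReal) : ℝ≥0∞ :=
  if x = ⊤ then ⊤ else ENNReal.ofReal x.toReal

/-- `ψ*(y) = sup_{x ∈ ℝ} (x·y − φ(x+1))`, the convex conjugate of `ψ(x) := φ(x+1)`.
Since `φ 1 = 0`, the supremum is nonnegative (take `x = 0`), so we record it in `ℝ≥0∞`. -/
noncomputable def psiStar (φ : ℝ → ℝ≥0∞) (y : ℝ) : ℝ≥0∞ :=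
  erealToENNReal (⨆ x : ℝ, ((x * y : ℝ) : EReal) - ((φ (x + 1) : ℝ≥0∞) : EReal))

/-- The `(φ,ν)`-cumulant generating function `Λ_{g,ν}(t) = inf_{λ ∈ ℝ} ∫ ψ*(t·g + λ) dν`. -/
noncomputable def cgf {Ω : Type*} [MeasurableSpace Ω] (φ : ℝ → ℝ≥0∞)
    (ν : Measure Ω) (g : Ω → ℝ) (t : ℝ) : ℝ≥0∞ :=
  ⨅ lam : ℝ, ∫⁻ ω, psiStar φ (t * g ω + lam) ∂ν

/-- The φ-divergence `D_φ(μ‖ν) = ∫ φ(dμ_c/dν) dν + φ'(∞)·μ_s(Ω)`, where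
`μ = μ_c + μ_s` is the Lebesgue decomposition of `μ` with respect to `ν` and
`dphi = φ'(∞)`; the convention `0·∞ = 0` is automatic in `ℝ≥0∞`. -/
noncomputable def divFull {Ω : Type*} [MeasurableSpace Ω] (φ : ℝ → ℝ≥0∞)
    (dphi : ℝ≥0∞) (μ ν : Measure Ω) : ℝ≥0∞ :=
  ∫⁻ ω, φ ((μ.rnDeriv ν ω).toReal) ∂ν + dphi * μ.singularPart ν Set.univ

/-- Total variation distance: `TV(μ,ν) = sup { |∫ g dμ − ∫ g dν| : g measurable, |g| ≤ 1 }`. -/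
noncomputable def tvDist {Ω : Type*} [MeasurableSpace Ω] (μ ν : Measure Ω) : ℝ :=
  sSup {r : ℝ | ∃ g : Ω → ℝ, Measurable g ∧ (∀ ω, |g ω| ≤ 1) ∧
    r = |∫ ω, g ω ∂μ - ∫ ω, g ω ∂ν|}

/-- `H(w) = inf_{λ ∈ ℝ} max(ψ*(λ + w/2), ψ*(λ − w/2))`, the height-for-width function
of `ψ*`. -/
noncomputable def heightMinMax (φ : ℝ → ℝ≥0∞) (w : ℝ) : ℝ≥0∞ :=
  ⨅ lam : ℝ, max (psiStar φ (lam + w / 2)) (psiStar φ (lam - w / 2))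

lemma psiStar_le_of {φ : ℝ → ℝ≥0∞} {y C : ℝ} (hC : 0 ≤ C)
    (h : ∀ a d : ℝ, 0 ≤ d → φ (1 + a) ≤ ENNReal.ofReal d → y * a - d ≤ C) :
    psiStar φ y ≤ ENNReal.ofReal C := by
  have key : (⨆ x : ℝ, ((x * y : ℝ) : EReal) - ((φ (x + 1) : ℝ≥0∞) : EReal)) ≤ (C : EReal) := by
    refine iSup_le fun x => ?_
    by_cases hx : φ (x + 1) = ⊤
    · rw [hx]; simp
    · rw [← EReal.coe_ennreal_toReal hx, ← EReal.coe_sub, EReal.coe_le_coe_iff]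
      have := h x (φ (x + 1)).toReal ENNReal.toReal_nonneg
        (by rw [ENNReal.ofReal_toReal hx, add_comm])
      linarith [mul_comm x y]
  unfold psiStar erealToENNReal
  rw [if_neg (ne_top_of_le_ne_top (EReal.coe_ne_top C) key)]
  apply ENNReal.ofReal_le_ofReal
  by_cases hb : (⨆ x : ℝ, ((x * y : ℝ) : EReal) - ((φ (x + 1) : ℝ≥0∞) : EReal)) = ⊥
  · rw [hb]; simpa using hC
  · simpa using EReal.toReal_le_toReal key hb (EReal.coe_ne_top C)

lemma le_of_psiStar_le {φ : ℝ → ℝ≥0∞} {y : ℝ} {M : ℝ≥0∞} (hM : M ≠ ⊤) (h : psiStar φ y ≤ M)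
    (x : ℝ) (hx : φ x ≠ ⊤) : (x - 1) * y - (φ x).toReal ≤ M.toReal := by
  unfold psiStar erealToENNReal at h
  split_ifs at h with htop
  · exact absurd (top_le_iff.1 h) hM
  · have h1 := le_iSup (fun x : ℝ => ((x * y : ℝ) : EReal) - ((φ (x + 1) : ℝ≥0∞) : EReal)) (x - 1)
    simp only [sub_add_cancel] at h1
    rw [← EReal.coe_ennreal_toReal hx, ← EReal.coe_sub] at h1
    have h2 := EReal.toReal_le_toReal h1 (EReal.coe_ne_bot _) htop
    rw [EReal.toReal_coe] at h2
    have h3 := (ENNReal.ofReal_le_iff_le_toReal hM).1 h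
    linarith

lemma heightMinMax_zero {φ : ℝ → ℝ≥0∞} : heightMinMax φ 0 = 0 := by
  unfold heightMinMax
  refine le_antisymm (iInf_le_of_le 0 ?_) bot_le
  have : psiStar φ 0 ≤ ENNReal.ofReal 0 := psiStar_le_of le_rfl (fun a d hd _ => by simpa using hd)
  simpa using this

lemma ofReal_le_dphi {φ : ℝ → ℝ≥0∞} {dphi : ℝ≥0∞}
    (hdphi : Tendsto (fun x : ℝ => φ x / ENNReal.ofReal x) atTop (𝓝 dphi)) {y m : ℝ}
    (h : ∀ x, φ x ≠ ⊤ → (x - 1) * y - (φ x).toReal ≤ m) : ENNReal.ofReal y ≤ dphi := by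
  have h1 : Tendsto (fun x : ℝ => y - (y + m) * x⁻¹) atTop (𝓝 (y - (y + m) * 0)) :=
    tendsto_const_nhds.sub (tendsto_const_nhds.mul tendsto_inv_atTop_zero)
  have h2 := (ENNReal.continuous_ofReal.tendsto _).comp h1
  simp only [mul_zero, sub_zero] at h2
  refine le_of_tendsto_of_tendsto h2 hdphi ?_
  filter_upwards [eventually_gt_atTop 0] with x hx
  by_cases hxt : φ x = ⊤
  · rw [hxt, ENNReal.top_div_of_ne_top ENNReal.ofReal_ne_top]; exact le_top
  · have := h x hxt
    have e : y - (y + m) * x⁻¹ = ((x - 1) * y - m) / x := by field_simp; ring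
    simp only [Function.comp]
    rw [e, ENNReal.ofReal_div_of_pos hx]
    gcongr
    exact ENNReal.ofReal_le_of_le_toReal (by linarith)

lemma young_bound {Ω : Type*} [MeasurableSpace Ω] {φ : ℝ → ℝ≥0∞}
    (hlsc : LowerSemicontinuous φ) {dphi : ℝ≥0∞}
    (hdphi : Tendsto (fun x : ℝ => φ x / ENNReal.ofReal x) atTop (𝓝 dphi))
    (μ ν : Measure Ω) [IsProbabilityMeasure μ] [IsProbabilityMeasure ν]
    (hD : divFull φ dphi μ ν ≠ ⊤) {h : Ω → ℝ} (hm : Measurable h) {B m : ℝ}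
    (hB : ∀ ω, |h ω| ≤ B)
    (hY : ∀ ω x, φ x ≠ ⊤ → (x - 1) * h ω - (φ x).toReal ≤ m) :
    ∫ ω, h ω ∂μ - ∫ ω, h ω ∂ν - m ≤ (divFull φ dphi μ ν).toReal := by
  have hint : ∀ (ρ : Measure Ω) [IsFiniteMeasure ρ], Integrable h ρ := fun ρ _ =>
    Integrable.of_bound hm.aestronglyMeasurable B (ae_of_all _ hB)
  unfold divFull at hD ⊢
  obtain ⟨hD1, hD2⟩ := ENNReal.add_ne_top.1 hD
  rw [ENNReal.toReal_add hD1 hD2]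
  have hφm : Measurable (fun ω => φ ((μ.rnDeriv ν ω).toReal)) :=
    hlsc.measurable.comp (Measure.measurable_rnDeriv μ ν).ennreal_toReal
  have hfin := ae_lt_top hφm hD1
  have hφi := integrable_toReal_of_lintegral_ne_top hφm.aemeasurable hD1
  have hri : Integrable (fun x => (μ.rnDeriv ν x).toReal) ν := Measure.integrable_toReal_rnDeriv
  have hrh : Integrable (fun x => (μ.rnDeriv ν x).toReal * h x) ν :=
    hri.mul_bdd (c := B) hm.aestronglyMeasurable (ae_of_all _ hB)
  have e1 : ∫ ω, h ω ∂μ = ∫ ω, h ω ∂(μ.singularPart ν) + ∫ ω, (μ.rnDeriv ν ω).toReal * h ω ∂ν := by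
    conv_lhs => rw [Measure.haveLebesgueDecomposition_add μ ν]
    rw [integral_add_measure (hint _) (hint _),
      integral_withDensity_eq_integral_toReal_smul (Measure.measurable_rnDeriv μ ν)
        (Measure.rnDeriv_lt_top μ ν)]
    rfl
  have e2 : ∫ ω, h ω ∂(μ.singularPart ν) ≤ (dphi * μ.singularPart ν Set.univ).toReal := by
    by_cases hs : μ.singularPart ν Set.univ = 0
    · rw [Measure.measure_univ_eq_zero] at hs
      simp [hs]
    · have hd : dphi ≠ ⊤ := fun hd => hD2 (by rw [hd, ENNReal.top_mul hs])
      have : ∫ ω, h ω ∂(μ.singularPart ν) ≤ ∫ ω, dphi.toReal ∂(μ.singularPart ν) := by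
        refine integral_mono (hint _) (integrable_const _) fun ω => ?_
        exact (ENNReal.ofReal_le_iff_le_toReal hd).1 (ofReal_le_dphi hdphi (hY ω))
      rw [integral_const] at this
      rw [ENNReal.toReal_mul]
      simpa [Measure.real, mul_comm] using this
  have e3 : ∫ ω, ((μ.rnDeriv ν ω).toReal * h ω - h ω - m) ∂ν
      ≤ ∫ ω, (φ ((μ.rnDeriv ν ω).toReal)).toReal ∂ν := by
    refine integral_mono_ae ((hrh.sub (hint ν)).sub (integrable_const m)) hφi ?_
    filter_upwards [hfin] with ω hω
    have := hY ω _ hω.ne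
    linarith
  rw [integral_toReal hφm.aemeasurable hfin] at e3
  have e4 : ∫ ω, ((μ.rnDeriv ν ω).toReal * h ω - h ω - m) ∂ν
      = ∫ ω, (μ.rnDeriv ν ω).toReal * h ω ∂ν - ∫ ω, h ω ∂ν - m := by
    have hsub : Integrable (fun ω => (μ.rnDeriv ν ω).toReal * h ω - h ω) ν := hrh.sub (hint ν)
    rw [integral_sub hsub (integrable_const m), integral_sub hrh (hint ν)]
    simp
  linarith

lemma lower_bound {Ω : Type*} [MeasurableSpace Ω] {φ : ℝ → ℝ≥0∞}
    (hlsc : LowerSemicontinuous φ) {dphi : ℝ≥0∞}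
    (hdphi : Tendsto (fun x : ℝ => φ x / ENNReal.ofReal x) atTop (𝓝 dphi))
    (μ ν : Measure Ω) [IsProbabilityMeasure μ] [IsProbabilityMeasure ν]
    (w : ℝ) (hw : 0 ≤ w) :
    (((w * tvDist μ ν / 2 : ℝ) : EReal) - ((heightMinMax φ w : ℝ≥0∞) : EReal))
      ≤ (divFull φ dphi μ ν : EReal) := by
  by_cases hD : divFull φ dphi μ ν = ⊤
  · rw [hD]; exact le_top
  have key : ∀ lam : ℝ, ENNReal.ofReal (w * tvDist μ ν / 2) ≤
      divFull φ dphi μ ν + max (psiStar φ (lam + w / 2)) (psiStar φ (lam - w / 2)) := by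
    intro lam
    set M := max (psiStar φ (lam + w / 2)) (psiStar φ (lam - w / 2)) with hMdef
    by_cases hM : M = ⊤
    · simp [hM]
    have h1 := fun x hx => le_of_psiStar_le (y := lam + w / 2) hM (le_max_left _ _) x hx
    have h2 := fun x hx => le_of_psiStar_le (y := lam - w / 2) hM (le_max_right _ _) x hx
    have hg : ∀ g : Ω → ℝ, Measurable g → (∀ ω, |g ω| ≤ 1) →
        w / 2 * (∫ ω, g ω ∂μ - ∫ ω, g ω ∂ν) ≤ (divFull φ dphi μ ν).toReal + M.toReal := by
      intro g hgm hgb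
      have hint : ∀ (ρ : Measure Ω) [IsFiniteMeasure ρ], Integrable g ρ := fun ρ _ =>
        Integrable.of_bound hgm.aestronglyMeasurable 1 (ae_of_all _ hgb)
      have := young_bound hlsc hdphi μ ν hD (h := fun ω => lam + w / 2 * g ω)
        (B := |lam| + w / 2) (m := M.toReal) (by fun_prop)
        (fun ω => by
          refine (abs_add_le _ _).trans ?_
          rw [abs_mul, abs_of_nonneg (by linarith : 0 ≤ w / 2)]
          nlinarith [hgb ω])
        (fun ω x hx => by
          have a1 := h1 x hx
          have a2 := h2 x hx
          obtain ⟨b1, b2⟩ := abs_le.1 (hgb ω)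
          have e : (x - 1) * (lam + w / 2 * g ω) =
            (1 + g ω) / 2 * ((x - 1) * (lam + w / 2)) + (1 - g ω) / 2 * ((x - 1) * (lam - w / 2)) := by
            ring
          rw [e]
          nlinarith [mul_le_mul_of_nonneg_left a1 (by linarith : 0 ≤ (1 + g ω) / 2),
            mul_le_mul_of_nonneg_left a2 (by linarith : 0 ≤ (1 - g ω) / 2)])
      rw [integral_add (integrable_const _) ((hint μ).const_mul _),
        integral_add (integrable_const _) ((hint ν).const_mul _),
        integral_const_mul, integral_const_mul] at this
      simp at this
      linarith
    rw [← ENNReal.ofReal_toReal (ENNReal.add_ne_top.2 ⟨hD, hM⟩), ENNReal.toReal_add hD hM]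
    apply ENNReal.ofReal_le_ofReal
    rcases hw.eq_or_lt with rfl | hw
    · simp; positivity
    have : tvDist μ ν ≤ ((divFull φ dphi μ ν).toReal + M.toReal) / (w / 2) := by
      unfold tvDist
      refine csSup_le ⟨_, fun _ => 0, measurable_const, by simp, rfl⟩ ?_
      rintro r ⟨g, hgm, hgb, rfl⟩
      rw [le_div_iff₀ (by linarith)]
      rcases abs_cases (∫ ω, g ω ∂μ - ∫ ω, g ω ∂ν) with ⟨e, _⟩ | ⟨e, _⟩
      · rw [e]; linarith [hg g hgm hgb]
      · have := hg (fun ω => - g ω) hgm.neg (by simpa using hgb)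
        rw [integral_neg, integral_neg] at this
        rw [e]; linarith
    rw [le_div_iff₀ (by linarith)] at this
    linarith
  have key2 : ENNReal.ofReal (w * tvDist μ ν / 2) ≤ divFull φ dphi μ ν + heightMinMax φ w := by
    unfold heightMinMax
    rw [ENNReal.add_iInf]
    exact le_iInf key
  rw [EReal.sub_le_iff_le_add (Or.inl (by simp)) (Or.inr (by simp)),
    ← EReal.coe_ennreal_add]
  refine le_trans ?_ (EReal.coe_ennreal_le_coe_ennreal_iff.2 key2)
  rw [EReal.coe_ennreal_ofReal, EReal.coe_le_coe_iff]
  exact le_max_left _ _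

/-- The two-point upper bound, with a singular part allowed. -/
lemma two_point {Ω : Type*} [MeasurableSpace Ω] {A : Set Ω} (hA : MeasurableSet A)
    {a b : Ω} (ha : a ∈ A) (hb : b ∉ A) (φ : ℝ → ℝ≥0∞) (dphi : ℝ≥0∞)
    {q t s x y : ℝ} (hq : 0 ≤ q) (hq1 : q ≤ 1) (ht : 0 ≤ t) (hqt : q + t ≤ 1)
    (hx : 0 ≤ x) (hy : 0 ≤ y) (hs : 0 ≤ s) (hsq : s = 0 ∨ q = 0)
    (e1 : q + t = s + q * x) (e2 : 1 - q - t = (1 - q) * y) :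
    ∃ μ ν : Measure Ω, IsProbabilityMeasure μ ∧ IsProbabilityMeasure ν ∧ tvDist μ ν = 2 * t ∧
      divFull φ dphi μ ν = ENNReal.ofReal q * φ x + ENNReal.ofReal (1 - q) * φ y
        + dphi * ENNReal.ofReal s := by
  classical
  set ν : Measure Ω := ENNReal.ofReal q • Measure.dirac a + ENNReal.ofReal (1 - q) • Measure.dirac b
    with hν
  set μ : Measure Ω := ENNReal.ofReal (q + t) • Measure.dirac a
    + ENNReal.ofReal (1 - q - t) • Measure.dirac b with hμ
  have hνp : IsProbabilityMeasure ν := ⟨by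
    simp [hν, ← ENNReal.ofReal_add hq (by linarith : 0 ≤ 1 - q)]⟩
  have hμp : IsProbabilityMeasure μ := ⟨by
    simp only [hμ, Measure.coe_add, Measure.coe_smul, Pi.add_apply, Pi.smul_apply, measure_univ,
      smul_eq_mul, mul_one]
    rw [← ENNReal.ofReal_add (by linarith) (by linarith)]
    simp⟩
  refine ⟨μ, ν, hμp, hνp, ?_, ?_⟩
  · have hdiff : ∀ g : Ω → ℝ, Measurable g → (∀ ω, |g ω| ≤ 1) →
        ∫ ω, g ω ∂μ - ∫ ω, g ω ∂ν = t * (g a - g b) := by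
      intro g hg hgb
      have hint : ∀ (ρ : Measure Ω) [IsFiniteMeasure ρ], Integrable g ρ := fun ρ _ =>
        Integrable.of_bound hg.aestronglyMeasurable 1 (ae_of_all _ hgb)
      have hi : ∀ (c : ℝ) (z : Ω), Integrable g (ENNReal.ofReal c • Measure.dirac z) := fun c z =>
        (hint _).smul_measure ENNReal.ofReal_ne_top
      rw [hμ, hν, integral_add_measure (hi _ _) (hi _ _), integral_add_measure (hi _ _) (hi _ _)]
      simp only [integral_smul_measure, integral_dirac' _ _ hg.stronglyMeasurable, smul_eq_mul]
      rw [ENNReal.toReal_ofReal hq, ENNReal.toReal_ofReal (by linarith),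
        ENNReal.toReal_ofReal (by linarith), ENNReal.toReal_ofReal (by linarith)]
      ring
    unfold tvDist
    refine IsGreatest.csSup_eq ⟨?_, ?_⟩
    · refine ⟨A.piecewise (fun _ => 1) (fun _ => -1),
        Measurable.piecewise hA measurable_const measurable_const, ?_, ?_⟩
      · intro ω
        by_cases h : ω ∈ A <;> simp [h]
      · rw [hdiff _ (Measurable.piecewise hA measurable_const measurable_const)
          (fun ω => by by_cases h : ω ∈ A <;> simp [h])]
        simp only [Set.piecewise, ha, hb, if_true, if_false]
        rw [abs_of_nonneg (by linarith)]
        ring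
    · rintro r ⟨g, hg, hgb, rfl⟩
      rw [hdiff g hg hgb, abs_mul, abs_of_nonneg ht]
      have := abs_sub (g a) (g b)
      nlinarith [hgb a, hgb b]
  · set f : Ω → ℝ≥0∞ := A.piecewise (fun _ => ENNReal.ofReal x) (fun _ => ENNReal.ofReal y) with hf
    have hfm : Measurable f := Measurable.piecewise hA measurable_const measurable_const
    have hfa : f a = ENNReal.ofReal x := by simp [hf, ha]
    have hfb : f b = ENNReal.ofReal y := by simp [hf, hb]
    have hsing : (ENNReal.ofReal s • Measure.dirac a) ⟂ₘ ν := by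
      rcases hsq with rfl | rfl
      · simp
      · refine ⟨Aᶜ, hA.compl, ?_, ?_⟩
        · simp [Measure.dirac_apply' _ hA.compl, ha]
        · simp [hν, Measure.dirac_apply' _ hA, hb]
    have hdec : μ = ENNReal.ofReal s • Measure.dirac a + ν.withDensity f := by
      rw [hν, withDensity_add_measure, withDensity_smul_measure, withDensity_smul_measure,
        dirac_withDensity' hfm, dirac_withDensity' hfm, hfa, hfb, smul_smul, smul_smul,
        ← ENNReal.ofReal_mul hq, ← ENNReal.ofReal_mul (by linarith), ← add_assoc, ← add_smul,
        ← ENNReal.ofReal_add hs (by positivity), ← e1, ← e2]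
    have hr := Measure.eq_rnDeriv hfm hsing hdec
    unfold divFull
    rw [← Measure.eq_singularPart hfm hsing hdec]
    have hcomp : (fun ω => φ ((f ω).toReal)) = A.piecewise (fun _ => φ x) (fun _ => φ y) := by
      ext ω
      by_cases h : ω ∈ A <;> simp [hf, h, hx, hy]
    have : ∫⁻ ω, φ ((μ.rnDeriv ν ω).toReal) ∂ν = ∫⁻ ω, φ ((f ω).toReal) ∂ν := by
      refine lintegral_congr_ae ?_
      filter_upwards [hr] with ω hω
      rw [hω]
    rw [this]
    have hcm : Measurable (A.piecewise (fun _ => φ x) (fun _ => φ y)) :=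
      Measurable.piecewise hA measurable_const measurable_const
    simp only [hcomp]
    rw [hν, lintegral_add_measure, lintegral_smul_measure, lintegral_smul_measure,
      lintegral_dirac' _ hcm, lintegral_dirac' _ hcm]
    simp [ha, hb]

lemma mem_closure_Iio_or_zero (X : ℝ≥0∞) : X ∈ closure (Iio X ∪ {0}) := by
  by_cases h : X = 0
  · subst h; exact subset_closure (by simp)
  · refine closure_mono subset_union_left ?_
    rw [closure_Iio' ⟨0, pos_iff_ne_zero.2 h⟩]
    exact self_mem_Iic

lemma le_of_forall_below {X Y α β W : ℝ≥0∞} (hα : α ≠ ⊤) (hβ : β ≠ ⊤)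
    (h : ∀ c d : ℝ, 0 ≤ c → 0 ≤ d → (ENNReal.ofReal c < X ∨ c = 0) →
      (ENNReal.ofReal d < Y ∨ d = 0) → α * ENNReal.ofReal c + β * ENNReal.ofReal d ≤ W) :
    α * X + β * Y ≤ W := by
  have hcl : IsClosed {p : ℝ≥0∞ × ℝ≥0∞ | α * p.1 + β * p.2 ≤ W} := by
    refine isClosed_le ?_ continuous_const
    exact ((ENNReal.continuous_const_mul hα).comp continuous_fst).add
      ((ENNReal.continuous_const_mul hβ).comp continuous_snd)
  have hmem : (X, Y) ∈ closure ((Iio X ∪ {0}) ×ˢ (Iio Y ∪ {0})) := by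
    rw [closure_prod_eq]
    exact ⟨mem_closure_Iio_or_zero X, mem_closure_Iio_or_zero Y⟩
  refine closure_minimal ?_ hcl hmem
  have aux : ∀ Z c : ℝ≥0∞, c ∈ Iio Z ∪ {0} →
      c = ENNReal.ofReal c.toReal ∧ (ENNReal.ofReal c.toReal < Z ∨ c.toReal = 0) := by
    rintro Z c (hc | hc)
    · have : c ≠ ⊤ := ne_top_of_lt hc
      rw [ENNReal.ofReal_toReal this]
      exact ⟨rfl, Or.inl hc⟩
    · rw [mem_singleton_iff] at hc
      subst hc; simp
  rintro ⟨c, d⟩ ⟨hc, hd⟩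
  obtain ⟨c1, c2⟩ := aux X c hc
  obtain ⟨d1, d2⟩ := aux Y d hd
  have := h c.toReal d.toReal ENNReal.toReal_nonneg ENNReal.toReal_nonneg c2 d2
  rw [← c1, ← d1] at this
  exact this

/-- Limit of two-point problems. -/
lemma limit_case {φ : ℝ → ℝ≥0∞} (hlsc : LowerSemicontinuous φ)
    (hneg : ∀ x : ℝ, x < 0 → φ x = ⊤) {dphi : ℝ≥0∞}
    (hdphi : Tendsto (fun x : ℝ => φ x / ENNReal.ofReal x) atTop (𝓝 dphi))
    {t V : ℝ} (ht : 0 < t) {q a b d e : ℕ → ℝ} {Q : ℝ}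
    (hq0 : ∀ n, 0 ≤ q n) (hq1 : ∀ n, q n ≤ 1) (hQ : Tendsto q atTop (𝓝 Q))
    (ha : ∀ n, 0 ≤ d n ∧ φ (1 + a n) ≤ ENNReal.ofReal (d n))
    (hb : ∀ n, 0 ≤ e n ∧ φ (1 + b n) ≤ ENNReal.ofReal (e n))
    (h1 : Tendsto (fun n => q n * a n) atTop (𝓝 t))
    (h2 : Tendsto (fun n => (1 - q n) * b n) atTop (𝓝 (-t)))
    (h3 : Tendsto (fun n => q n * d n + (1 - q n) * e n) atTop (𝓝 V)) :
    (0 < Q ∧ Q < 1 ∧ ENNReal.ofReal Q * φ (1 + t / Q) +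
        ENNReal.ofReal (1 - Q) * φ (1 + -t / (1 - Q)) ≤ ENNReal.ofReal V) ∨
    (Q = 0 ∧ ENNReal.ofReal t * dphi + 1 * φ (1 - t) ≤ ENNReal.ofReal V) := by
  have hQ0 : 0 ≤ Q := ge_of_tendsto' hQ hq0
  have hQ1 : Q ≤ 1 := le_of_tendsto' hQ hq1
  have hQ1' : Q < 1 := by
    refine lt_of_le_of_ne hQ1 fun hQe => ?_
    have l : Tendsto (fun n => -(1 - q n)) atTop (𝓝 (-(1 - Q))) := (tendsto_const_nhds.sub hQ).neg
    have := le_of_tendsto_of_tendsto' l h2 fun n => by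
      have hbn : -1 ≤ b n := by
        by_contra hlt
        have := (hb n).2
        rw [hneg _ (by linarith)] at this
        exact absurd (top_le_iff.1 this) ENNReal.ofReal_ne_top
      nlinarith [hq1 n]
    rw [hQe] at this
    linarith
  have hQ1q : Tendsto (fun n => 1 - q n) atTop (𝓝 (1 - Q)) := tendsto_const_nhds.sub hQ
  have hbl : Tendsto (fun n => 1 + b n) atTop (𝓝 (1 + -t / (1 - Q))) := by
    refine Tendsto.const_add _ ((h2.div hQ1q (by linarith)).congr' ?_)
    filter_upwards [hQ1q.eventually_ne (by linarith : 1 - Q ≠ 0)] with n hn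
    simp only [Pi.div_apply]
    field_simp
  -- eventual lower bound from lsc
  have low : ∀ (u v : ℕ → ℝ) (l c : ℝ), Tendsto u atTop (𝓝 l) →
      (∀ n, 0 ≤ v n ∧ φ (u n) ≤ ENNReal.ofReal (v n)) →
      0 ≤ c → (ENNReal.ofReal c < φ l ∨ c = 0) → ∀ᶠ n in atTop, c ≤ v n := by
    intro u v l c hu hv hc hcl
    rcases hcl with hcl | rfl
    · filter_upwards [hu.eventually (hlsc l _ hcl)] with n hn
      by_contra hlt
      exact absurd (hn.trans_le (hv n).2) (not_lt.2 (ENNReal.ofReal_le_ofReal (by linarith)))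
    · exact Eventually.of_forall fun n => (hv n).1
  rcases hQ0.eq_or_lt with hQz | hQp
  · right
    refine ⟨hQz.symm, ?_⟩
    subst hQz
    refine le_of_forall_below ENNReal.ofReal_ne_top ENNReal.one_ne_top ?_
    intro c₁ c₂ hc₁ hc₂ hX hY
    rw [one_mul, ← ENNReal.ofReal_mul ht.le, ← ENNReal.ofReal_add (by positivity) hc₂]
    apply ENNReal.ofReal_le_ofReal
    have E2 := low _ e _ c₂ hbl hb hc₂ (by simpa [sub_eq_add_neg] using hY)
    have hat : Tendsto (fun n => 1 + a n) atTop atTop := by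
      refine tendsto_atTop_add_const_left _ _ ?_
      rw [tendsto_atTop]
      intro K
      have hK : Tendsto (fun n => q n * max K 0) atTop (𝓝 (0 * max K 0)) := hQ.mul_const _
      rw [zero_mul] at hK
      filter_upwards [hK.eventually_lt h1 ht] with n hn
      by_contra hlt
      have : a n ≤ max K 0 := (not_le.1 hlt).le.trans (le_max_left _ _)
      nlinarith [hq0 n, mul_le_mul_of_nonneg_left this (hq0 n)]
    have E1 : ∀ᶠ n in atTop, c₁ * a n ≤ d n := by
      rcases hX with hX | rfl
      · filter_upwards [(hdphi.comp hat).eventually_const_lt hX, hat.eventually_gt_atTop 0]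
          with n hn hn0
        simp only [Function.comp] at hn
        have h4 := ENNReal.mul_lt_of_lt_div hn
        rw [← ENNReal.ofReal_mul hc₁] at h4
        have h5 := h4.le.trans (ha n).2
        rw [ENNReal.ofReal_le_ofReal_iff (ha n).1] at h5
        nlinarith
      · refine Eventually.of_forall fun n => ?_
        simpa using (ha n).1
    have L : Tendsto (fun n => c₁ * (q n * a n) + (1 - q n) * c₂) atTop
        (𝓝 (c₁ * t + (1 - 0) * c₂)) := (h1.const_mul _).add (hQ1q.mul_const _)
    have := le_of_tendsto_of_tendsto L h3 (by
      filter_upwards [E1, E2] with n hn1 hn2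
      nlinarith [mul_le_mul_of_nonneg_left hn1 (hq0 n),
        mul_le_mul_of_nonneg_left hn2 (by linarith [hq1 n] : 0 ≤ 1 - q n)])
    linarith
  · left
    refine ⟨hQp, hQ1', ?_⟩
    refine le_of_forall_below ENNReal.ofReal_ne_top ENNReal.ofReal_ne_top ?_
    intro c₁ c₂ hc₁ hc₂ hX hY
    rw [← ENNReal.ofReal_mul hQ0, ← ENNReal.ofReal_mul (by linarith),
      ← ENNReal.ofReal_add (by positivity) (mul_nonneg (by linarith) hc₂)]
    apply ENNReal.ofReal_le_ofReal
    have hal : Tendsto (fun n => 1 + a n) atTop (𝓝 (1 + t / Q)) := by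
      refine Tendsto.const_add _ ((h1.div hQ hQp.ne').congr' ?_)
      filter_upwards [hQ.eventually_ne hQp.ne'] with n hn
      simp only [Pi.div_apply]
      field_simp
    have E2 := low _ e _ c₂ hbl hb hc₂ hY
    have E1 := low _ d _ c₁ hal ha hc₁ hX
    have L : Tendsto (fun n => q n * c₁ + (1 - q n) * c₂) atTop
        (𝓝 (Q * c₁ + (1 - Q) * c₂)) := (hQ.mul_const _).add (hQ1q.mul_const _)
    exact le_of_tendsto_of_tendsto L h3 (by
      filter_upwards [E1, E2] with n hn1 hn2
      nlinarith [mul_le_mul_of_nonneg_left hn1 (hq0 n),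
        mul_le_mul_of_nonneg_left hn2 (by linarith [hq1 n] : 0 ≤ 1 - q n)])

lemma epi_combo {φ : ℝ → ℝ≥0∞}
    (hconv : ∀ x y : ℝ, ∀ a b : ℝ≥0, a + b = 1 →
      φ ((a : ℝ) * x + (b : ℝ) * y) ≤ (a : ℝ≥0∞) * φ x + (b : ℝ≥0∞) * φ y)
    {x y d e α β : ℝ} (hα : 0 ≤ α) (hβ : 0 ≤ β) (hαβ : α + β = 1) (hd : 0 ≤ d) (he : 0 ≤ e)
    (hx : φ (1 + x) ≤ ENNReal.ofReal d) (hy : φ (1 + y) ≤ ENNReal.ofReal e) :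
    φ (1 + (α * x + β * y)) ≤ ENNReal.ofReal (α * d + β * e) := by
  have h := hconv (1 + x) (1 + y) α.toNNReal β.toNNReal
    (by rw [← Real.toNNReal_add hα hβ, hαβ, Real.toNNReal_one])
  rw [Real.coe_toNNReal _ hα, Real.coe_toNNReal _ hβ,
    show α * (1 + x) + β * (1 + y) = 1 + (α * x + β * y) by linear_combination hαβ] at h
  change _ ≤ ENNReal.ofReal α * _ + ENNReal.ofReal β * _ at h
  refine h.trans ?_
  rw [ENNReal.ofReal_add (by positivity) (by positivity), ENNReal.ofReal_mul hα,
    ENNReal.ofReal_mul hβ]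
  gcongr

def epiOne (φ : ℝ → ℝ≥0∞) : Set (ℝ × ℝ × ℝ) :=
  {p | p.2.1 = 0 ∧ 0 ≤ p.2.2 ∧ φ (1 + p.1) ≤ ENNReal.ofReal p.2.2}

def epiTwo (φ : ℝ → ℝ≥0∞) : Set (ℝ × ℝ × ℝ) :=
  {p | p.1 = 0 ∧ 0 ≤ p.2.2 ∧ φ (1 + p.2.1) ≤ ENNReal.ofReal p.2.2}

lemma mem_closure_hull {φ : ℝ → ℝ≥0∞} (hone : φ 1 = 0) {t z : ℝ} (ht : 0 < t)
    (hz : (⨆ (w : ℝ) (_ : 0 ≤ w),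
      (((w * (2 * t) / 2 : ℝ) : EReal) - ((heightMinMax φ w : ℝ≥0∞) : EReal))) < (z : EReal)) :
    ((t, -t, z) : ℝ × ℝ × ℝ) ∈ closure (convexHull ℝ (epiOne φ ∪ epiTwo φ)) := by
  by_contra hnot
  have hz0 : 0 < z := by
    have h0 : (0 : EReal) ≤ ⨆ (w : ℝ) (_ : 0 ≤ w),
        (((w * (2 * t) / 2 : ℝ) : EReal) - ((heightMinMax φ w : ℝ≥0∞) : EReal)) := by
      refine le_iSup₂_of_le 0 le_rfl ?_
      rw [heightMinMax_zero]; simp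
    exact_mod_cast h0.trans_lt hz
  obtain ⟨f, c, hf1, hf2⟩ := geometric_hahn_banach_closed_point
    (convex_convexHull ℝ (epiOne φ ∪ epiTwo φ)).closure isClosed_closure hnot
  set u := f (1, 0, 0) with hu
  set v := f (0, 1, 0) with hv
  set s := f (0, 0, 1) with hs
  have hfe : ∀ x y d : ℝ, f (x, y, d) = u * x + v * y + s * d := by
    intro x y d
    have : ((x, y, d) : ℝ × ℝ × ℝ) = x • (1, 0, 0) + y • (0, 1, 0) + d • (0, 0, 1) := by
      simp
    rw [this, map_add, map_add, map_smul, map_smul, map_smul]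
    simp only [smul_eq_mul, ← hu, ← hv, ← hs]
    ring
  have hE1 : ∀ x d : ℝ, 0 ≤ d → φ (1 + x) ≤ ENNReal.ofReal d → u * x + s * d < c := by
    intro x d hd hx
    have := hf1 (x, 0, d) (subset_closure (subset_convexHull ℝ _ (Or.inl ⟨rfl, hd, hx⟩)))
    rw [hfe] at this
    linarith
  have hE2 : ∀ x d : ℝ, 0 ≤ d → φ (1 + x) ≤ ENNReal.ofReal d → v * x + s * d < c := by
    intro x d hd hx
    have := hf1 (0, x, d) (subset_closure (subset_convexHull ℝ _ (Or.inr ⟨rfl, hd, hx⟩)))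
    rw [hfe] at this
    linarith
  rw [hfe] at hf2
  have hd0 : ∀ d : ℝ, 0 ≤ d → s * d < c := fun d hd => by
    simpa using hE1 0 d hd (by simp [hone])
  have hc : 0 < c := by simpa using hd0 0 le_rfl
  have hs0 : s ≤ 0 := by
    by_contra hsp
    have hsp : 0 < s := not_le.1 hsp
    have := hd0 (c / s) (by positivity)
    rw [mul_div_cancel₀ _ hsp.ne'] at this
    exact lt_irrefl _ this
  -- the basic dual bound
  have dual : ∀ k : ℝ, 0 < k → 0 ≤ 1 + k * s → (k * (u - v)) * t - k * c < z := by
    intro k hk hks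
    by_contra hcon
    have hcon := not_lt.1 hcon
    have hw : 0 ≤ k * (u - v) := by
      by_contra hneg
      have : k * (u - v) < 0 := not_le.1 hneg
      nlinarith [mul_pos hk hc]
    have hC : 0 ≤ k * c := by positivity
    have p1 : psiStar φ (k * u) ≤ ENNReal.ofReal (k * c) := psiStar_le_of hC fun x d hd hx => by
      nlinarith [mul_le_mul_of_nonneg_left (hE1 x d hd hx).le hk.le]
    have p2 : psiStar φ (k * v) ≤ ENNReal.ofReal (k * c) := psiStar_le_of hC fun x d hd hx => by
      nlinarith [mul_le_mul_of_nonneg_left (hE2 x d hd hx).le hk.le]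
    have hH : heightMinMax φ (k * (u - v)) ≤ ENNReal.ofReal (k * c) := by
      unfold heightMinMax
      refine iInf_le_of_le (k * (u + v) / 2) ?_
      rw [show k * (u + v) / 2 + k * (u - v) / 2 = k * u by ring,
        show k * (u + v) / 2 - k * (u - v) / 2 = k * v by ring]
      exact max_le p1 p2
    have h1 := (le_iSup₂ (f := fun (w : ℝ) (_ : 0 ≤ w) =>
      (((w * (2 * t) / 2 : ℝ) : EReal) - ((heightMinMax φ w : ℝ≥0∞) : EReal)))
      (k * (u - v)) hw).trans_lt hz
    have h2 : ((k * (u - v) * (2 * t) / 2 - k * c : ℝ) : EReal) ≤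
        ((k * (u - v) * (2 * t) / 2 : ℝ) : EReal) -
          ((heightMinMax φ (k * (u - v)) : ℝ≥0∞) : EReal) := by
      rw [EReal.coe_sub]
      refine EReal.sub_le_sub le_rfl ?_
      refine (EReal.coe_ennreal_le_coe_ennreal_iff.2 hH).trans ?_
      rw [EReal.coe_ennreal_ofReal, max_eq_left hC]
    have h3 := EReal.coe_lt_coe_iff.1 (h2.trans_lt h1)
    linarith
  rcases hs0.eq_or_lt with hs0 | hs0
  · rw [hs0] at hf2
    have hδ : 0 < (u - v) * t - c := by linarith
    have := dual (z / ((u - v) * t - c)) (by positivity) (by rw [hs0]; simp)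
    have e : z / ((u - v) * t - c) * (u - v) * t - z / ((u - v) * t - c) * c = z := by
      field_simp
    linarith
  · have hp : 0 < -s := by linarith
    have := dual (1 / (-s)) (by positivity) (by
      have : 1 / (-s) * s = -1 := by
        have := hs0.ne
        field_simp
      linarith)
    have e : 1 / (-s) * (u - v) * t - 1 / (-s) * c = ((u - v) * t - c) / (-s) := by ring
    rw [e, div_lt_iff₀ hp] at this
    linarith

lemma upper_bound {Ω : Type*} [MeasurableSpace Ω] {A : Set Ω} (hA : MeasurableSet A)
    {a₀ b₀ : Ω} (ha₀ : a₀ ∈ A) (hb₀ : b₀ ∉ A)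
    {φ : ℝ → ℝ≥0∞}
    (hconv : ∀ x y : ℝ, ∀ a b : ℝ≥0, a + b = 1 →
      φ ((a : ℝ) * x + (b : ℝ) * y) ≤ (a : ℝ≥0∞) * φ x + (b : ℝ≥0∞) * φ y)
    (hlsc : LowerSemicontinuous φ)
    (hneg : ∀ x : ℝ, x < 0 → φ x = ⊤)
    (hone : φ 1 = 0) {dphi : ℝ≥0∞}
    (hdphi : Tendsto (fun x : ℝ => φ x / ENNReal.ofReal x) atTop (𝓝 dphi))
    {t z : ℝ} (ht : 0 ≤ t)
    (hz : (⨆ (w : ℝ) (_ : 0 ≤ w),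
      (((w * (2 * t) / 2 : ℝ) : EReal) - ((heightMinMax φ w : ℝ≥0∞) : EReal))) < (z : EReal)) :
    ∃ μ ν : Measure Ω, IsProbabilityMeasure μ ∧ IsProbabilityMeasure ν ∧ tvDist μ ν = 2 * t ∧
      divFull φ dphi μ ν ≤ ENNReal.ofReal z := by
  rcases ht.eq_or_lt with rfl | ht
  · obtain ⟨μ, ν, h1, h2, h3, h4⟩ := two_point hA ha₀ hb₀ φ dphi (q := 0) (t := 0) (s := 0)
      (x := 1) (y := 1) le_rfl zero_le_one le_rfl (by simp) zero_le_one zero_le_one le_rfl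
      (Or.inl rfl) (by simp) (by simp)
    exact ⟨μ, ν, h1, h2, h3, by rw [h4]; simp [hone]⟩
  have hmem := mem_closure_hull hone ht hz
  have hc1 : Convex ℝ (epiOne φ) := by
    rintro ⟨x, x', d⟩ ⟨h1, h2, h3⟩ ⟨y, y', e⟩ ⟨g1, g2, g3⟩ α β hα hβ hαβ
    simp only at h1 h2 h3 g1 g2 g3
    refine ⟨by simp [h1, g1], ?_, ?_⟩
    · simp only [Prod.smul_mk, Prod.mk_add_mk, smul_eq_mul]; positivity
    · simpa using epi_combo hconv hα hβ hαβ h2 g2 h3 g3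
  have hc2 : Convex ℝ (epiTwo φ) := by
    rintro ⟨x', x, d⟩ ⟨h1, h2, h3⟩ ⟨y', y, e⟩ ⟨g1, g2, g3⟩ α β hα hβ hαβ
    simp only at h1 h2 h3 g1 g2 g3
    refine ⟨by simp [h1, g1], ?_, ?_⟩
    · simp only [Prod.smul_mk, Prod.mk_add_mk, smul_eq_mul]; positivity
    · simpa using epi_combo hconv hα hβ hαβ h2 g2 h3 g3
  rw [convexHull_union ⟨(0, 0, 0), by simp [epiOne, hone]⟩ ⟨(0, 0, 0), by simp [epiTwo, hone]⟩,
    hc1.convexHull_eq, hc2.convexHull_eq, mem_closure_iff_seq_limit] at hmem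
  obtain ⟨X, hX, hXl⟩ := hmem
  have hX' : ∀ n, ∃ q x y d e : ℝ, 0 ≤ q ∧ q ≤ 1 ∧ (0 ≤ d ∧ φ (1 + x) ≤ ENNReal.ofReal d) ∧
      (0 ≤ e ∧ φ (1 + y) ≤ ENNReal.ofReal e) ∧
      X n = (q * x, (1 - q) * y, q * d + (1 - q) * e) := by
    intro n
    obtain ⟨⟨x, x', d⟩, ⟨h1, h2⟩, ⟨y', y, e⟩, ⟨g1, g2⟩, α, β, hα, hβ, hαβ, hXe⟩ :=
      mem_convexJoin.1 (hX n)
    simp only at h1 h2 g1 g2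
    have hβe : β = 1 - α := by linarith
    refine ⟨α, x, y, d, e, hα, by linarith, h2, g2, ?_⟩
    rw [← hXe, h1, g1, ← hβe]
    simp
  choose q x y d e hq0 hq1 hx hy hXe using hX'
  obtain ⟨Q, -, σ, hσ, hQ⟩ := (isCompact_Icc (a := (0 : ℝ)) (b := 1)).tendsto_subseq
    (fun n => ⟨hq0 n, hq1 n⟩)
  have hXl' := hXl.comp hσ.tendsto_atTop
  rw [Prod.tendsto_iff, Prod.tendsto_iff] at hXl'
  obtain ⟨l1, l2, l3⟩ := hXl'
  simp only [Function.comp, hXe] at l1 l2 l3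
  rcases limit_case hlsc hneg hdphi ht (fun n => hq0 (σ n)) (fun n => hq1 (σ n)) hQ
    (fun n => hx (σ n)) (fun n => hy (σ n)) l1 l2 l3 with ⟨hQ0, hQ1, hle⟩ | ⟨rfl, hle⟩
  · have hQ1' : 0 < 1 - Q := by linarith
    have hyn : 0 ≤ 1 + -t / (1 - Q) := by
      by_contra hlt
      rw [hneg _ (not_le.1 hlt), ENNReal.mul_top (by simpa using hQ1), add_top] at hle
      exact absurd (top_le_iff.1 hle) ENNReal.ofReal_ne_top
    have e2 : 1 - Q - t = (1 - Q) * (1 + -t / (1 - Q)) := by field_simp; ring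
    obtain ⟨μ, ν, h1, h2, h3, h4⟩ := two_point hA ha₀ hb₀ φ dphi (q := Q) (t := t) (s := 0)
      (x := 1 + t / Q) (y := 1 + -t / (1 - Q)) hQ0.le hQ1.le ht.le
      (by nlinarith [mul_nonneg hQ1'.le hyn]) (by positivity) hyn le_rfl
      (Or.inl rfl) (by field_simp; ring) e2
    exact ⟨μ, ν, h1, h2, h3, by rw [h4]; simpa using hle⟩
  · have hyn : 0 ≤ 1 - t := by
      by_contra hlt
      rw [hneg _ (not_le.1 hlt), one_mul, add_top] at hle
      exact absurd (top_le_iff.1 hle) ENNReal.ofReal_ne_top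
    obtain ⟨μ, ν, h1, h2, h3, h4⟩ := two_point hA ha₀ hb₀ φ dphi (q := 0) (t := t) (s := t)
      (x := 1) (y := 1 - t) le_rfl zero_le_one ht.le
      (by linarith) zero_le_one hyn ht.le (Or.inr rfl) (by ring) (by ring)
    refine ⟨μ, ν, h1, h2, h3, ?_⟩
    rw [h4]
    simpa [mul_comm, add_comm] using hle

/-- **Solution of Vajda's problem.**  On a nontrivial measurable space, for every
`ε ≥ 0`, the optimal lower bound of the φ-divergence at total variation `ε` is the convex
conjugate of the height-for-width function:
`inf { D_φ(μ‖ν) : TV(μ,ν) = ε } = sup_{w ≥ 0} (w·ε/2 − H(w))` (inf ∅ = +∞). -/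
theorem vajda_problem {Ω : Type*} [MeasurableSpace Ω]
    (hΩ : ∃ A : Set Ω, MeasurableSet A ∧ A ≠ ∅ ∧ A ≠ Set.univ)
    (φ : ℝ → ℝ≥0∞)
    (hconv : ∀ x y : ℝ, ∀ a b : ℝ≥0, a + b = 1 →
      φ ((a : ℝ) * x + (b : ℝ) * y) ≤ (a : ℝ≥0∞) * φ x + (b : ℝ≥0∞) * φ y)
    (hlsc : LowerSemicontinuous φ)
    (hneg : ∀ x : ℝ, x < 0 → φ x = ⊤)
    (hone : φ 1 = 0)
    (hdom : (1 : ℝ) ∈ interior {x : ℝ | φ x ≠ ⊤})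
    (dphi : ℝ≥0∞)
    (hdphi : Tendsto (fun x : ℝ => φ x / ENNReal.ofReal x) atTop (𝓝 dphi)) :
    ∀ ε : ℝ, 0 ≤ ε →
      ((⨅ (μ : Measure Ω) (ν : Measure Ω)
          (_ : IsProbabilityMeasure μ ∧ IsProbabilityMeasure ν ∧ tvDist μ ν = ε),
          divFull φ dphi μ ν : ℝ≥0∞) : EReal)
        = ⨆ (w : ℝ) (_ : 0 ≤ w),
            (((w * ε / 2 : ℝ) : EReal) - ((heightMinMax φ w : ℝ≥0∞) : EReal)) := by
  intro ε hε
  apply le_antisymm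
  · rw [← EReal.le_of_forall_lt_iff_le]
    intro z hz
    obtain ⟨A, hA, hA1, hA2⟩ := hΩ
    obtain ⟨a₀, ha₀⟩ := Set.nonempty_iff_ne_empty.2 hA1
    obtain ⟨b₀, hb₀⟩ := (Set.ne_univ_iff_exists_notMem A).1 hA2
    have hε2 : 2 * (ε / 2) = ε := by ring
    obtain ⟨μ, ν, h1, h2, h3, h4⟩ := upper_bound hA ha₀ hb₀ hconv hlsc hneg hone hdphi
      (t := ε / 2) (z := z) (by positivity) (by rw [hε2]; exact hz)
    rw [hε2] at h3
    have hz0 : 0 ≤ z := by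
      have h0 : (0 : EReal) ≤ ⨆ (w : ℝ) (_ : 0 ≤ w),
          (((w * ε / 2 : ℝ) : EReal) - ((heightMinMax φ w : ℝ≥0∞) : EReal)) := by
        refine le_iSup₂_of_le 0 le_rfl ?_
        rw [heightMinMax_zero]; simp
      exact_mod_cast (h0.trans_lt hz).le
    have hle : (⨅ (μ : Measure Ω) (ν : Measure Ω)
          (_ : IsProbabilityMeasure μ ∧ IsProbabilityMeasure ν ∧ tvDist μ ν = ε),
          divFull φ dphi μ ν) ≤ ENNReal.ofReal z :=
      iInf_le_of_le μ (iInf_le_of_le ν (iInf_le_of_le ⟨h1, h2, h3⟩ h4))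
    refine (EReal.coe_ennreal_le_coe_ennreal_iff.2 hle).trans ?_
    rw [EReal.coe_ennreal_ofReal, max_eq_left hz0]
  · refine iSup₂_le fun w hw => ?_
    rw [EReal.sub_le_iff_le_add (Or.inl (by simp)) (Or.inr (by simp)), ← EReal.coe_ennreal_add]
    have : ENNReal.ofReal (w * ε / 2) ≤ (⨅ (μ : Measure Ω) (ν : Measure Ω)
          (_ : IsProbabilityMeasure μ ∧ IsProbabilityMeasure ν ∧ tvDist μ ν = ε),
          divFull φ dphi μ ν) + heightMinMax φ w := by
      rw [← tsub_le_iff_right]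
      refine le_iInf fun μ => le_iInf fun ν => le_iInf fun ⟨h1, h2, h3⟩ => ?_
      rw [tsub_le_iff_right]
      have h := lower_bound (φ := φ) hlsc hdphi μ ν w hw
      rw [h3, EReal.sub_le_iff_le_add (Or.inl (by simp)) (Or.inr (by simp)),
        ← EReal.coe_ennreal_add] at h
      rw [← EReal.coe_ennreal_le_coe_ennreal_iff, EReal.coe_ennreal_ofReal,
        max_eq_left (by positivity)]
      exact h
    refine le_trans ?_ (EReal.coe_ennreal_le_coe_ennreal_iff.2 this)
    rw [EReal.coe_ennreal_ofReal, EReal.coe_le_coe_iff]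
    exact le_max_left _ _
end

section
/- If φ is twice differentiable on the interior of its domain and φ'' is monotone there (either nondecreasing or nonincreasing on the interior of dom φ), then for all probability measures μ, ν on any measurable space (Ω,F): D_φ(μ‖ν) ≥ (φ''(1)/8) · TV(μ,ν)². -/
open MeasureTheory Filter Set
open scoped ENNReal NNReal Topology

theorem aux_taylor (F d1 d2 : ℝ → ℝ) (I : Set ℝ) (hI : Convex ℝ I) (h1 : (1 : ℝ) ∈ I)
    (hF : ∀ x, 0 ≤ F x) (hF1 : F 1 = 0)
    (hd1 : ∀ x ∈ I, HasDerivAt F (d1 x) x) (hd2 : ∀ x ∈ I, HasDerivAt d1 (d2 x) x)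
    (c x : ℝ) (hx : x ∈ I)
    (hc : ∀ t ∈ Icc (0 : ℝ) 1, c ≤ d2 (1 + t * (x - 1))) :
    c / 2 * (x - 1) ^ 2 ≤ F x := by
  have hd10 : d1 1 = 0 := by
    refine IsLocalMin.hasDerivAt_eq_zero (f := F) (a := 1) ?_ (hd1 1 h1)
    exact Filter.Eventually.of_forall fun y => by simpa [hF1] using hF y
  have hmem : ∀ t ∈ Icc (0 : ℝ) 1, 1 + t * (x - 1) ∈ I := by
    intro t ht
    have := hI h1 hx (a := 1 - t) (b := t) (by linarith [ht.2]) ht.1 (by ring)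
    simp only [smul_eq_mul] at this
    convert this using 1
    ring
  have hlin : ∀ t : ℝ, HasDerivAt (fun t : ℝ => 1 + t * (x - 1)) (x - 1) t := by
    intro t
    simpa using ((hasDerivAt_id t).mul_const (x - 1)).const_add 1
  have hG1 : ∀ t ∈ Icc (0 : ℝ) 1, HasDerivAt (fun t : ℝ => d1 (1 + t * (x - 1)) * (x - 1) - c * (x - 1) ^ 2 * t)
      (d2 (1 + t * (x - 1)) * (x - 1) * (x - 1) - c * (x - 1) ^ 2) t := by
    intro t ht
    have h := ((hd2 _ (hmem t ht)).comp t (hlin t)).mul_const (x - 1)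
    have h' := (hasDerivAt_id t).const_mul (c * (x - 1) ^ 2)
    have h3 := h.sub h'
    rw [mul_one] at h3
    exact h3
  have hG0 : ∀ t ∈ Icc (0 : ℝ) 1, HasDerivAt (fun t : ℝ => F (1 + t * (x - 1)) - c * (x - 1) ^ 2 / 2 * t ^ 2)
      (d1 (1 + t * (x - 1)) * (x - 1) - c * (x - 1) ^ 2 * t) t := by
    intro t ht
    have h := ((hd1 _ (hmem t ht)).comp t (hlin t))
    have h' := (hasDerivAt_pow 2 t).const_mul (c * (x - 1) ^ 2 / 2)
    have h3 := h.sub h'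
    have e : c * (x - 1) ^ 2 / 2 * (((2 : ℕ) : ℝ) * t ^ (2 - 1)) = c * (x - 1) ^ 2 * t := by
      norm_num
      ring
    rw [e] at h3
    exact h3
  have m1 : MonotoneOn (fun t : ℝ => d1 (1 + t * (x - 1)) * (x - 1) - c * (x - 1) ^ 2 * t) (Icc 0 1) := by
    refine monotoneOn_of_deriv_nonneg (convex_Icc 0 1)
      (fun t ht => (hG1 t ht).continuousAt.continuousWithinAt)
      (fun t ht => (hG1 t (interior_subset ht)).differentiableAt.differentiableWithinAt) ?_
    intro t ht
    rw [(hG1 t (interior_subset ht)).deriv]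
    nlinarith [hc t (interior_subset ht), sq_nonneg (x - 1)]
  have m0 : MonotoneOn (fun t : ℝ => F (1 + t * (x - 1)) - c * (x - 1) ^ 2 / 2 * t ^ 2) (Icc 0 1) := by
    refine monotoneOn_of_deriv_nonneg (convex_Icc 0 1)
      (fun t ht => (hG0 t ht).continuousAt.continuousWithinAt)
      (fun t ht => (hG0 t (interior_subset ht)).differentiableAt.differentiableWithinAt) ?_
    intro t ht
    have ht' := interior_subset ht
    rw [(hG0 t ht').deriv]
    have := m1 (left_mem_Icc.2 zero_le_one) ht' ht'.1
    simpa [hd10] using this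
  have := m0 (left_mem_Icc.2 zero_le_one) (right_mem_Icc.2 zero_le_one) zero_le_one
  simp [hF1] at this
  linarith

theorem aux_bound (φ : ℝ → ℝ≥0∞)
    (hconv : ∀ x y : ℝ, ∀ a b : ℝ≥0, a + b = 1 →
      φ ((a : ℝ) * x + (b : ℝ) * y) ≤ (a : ℝ≥0∞) * φ x + (b : ℝ≥0∞) * φ y)
    (hone : φ 1 = 0)
    (hdom : (1 : ℝ) ∈ interior {x : ℝ | φ x ≠ ⊤})
    (d1 d2 : ℝ → ℝ)
    (hd1 : ∀ x ∈ interior {x : ℝ | φ x ≠ ⊤},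
      HasDerivAt (fun y : ℝ => (φ y).toReal) (d1 x) x)
    (hd2 : ∀ x ∈ interior {x : ℝ | φ x ≠ ⊤}, HasDerivAt d1 (d2 x) x)
    (c x : ℝ)
    (hc : ∀ t ∈ Icc (0 : ℝ) 1, 1 + t * (x - 1) ∈ interior {x : ℝ | φ x ≠ ⊤} →
      c ≤ d2 (1 + t * (x - 1))) :
    ENNReal.ofReal (c / 2 * (x - 1) ^ 2) ≤ φ x := by
  by_cases hx : φ x = ⊤
  · simp [hx]
  have hconv' : ∀ x y a b : ℝ, 0 ≤ a → 0 ≤ b → a + b = 1 →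
      φ (a * x + b * y) ≤ ENNReal.ofReal a * φ x + ENNReal.ofReal b * φ y := by
    intro x y a b ha hb hab
    have := hconv x y a.toNNReal b.toNNReal (by
      rw [← Real.toNNReal_add ha hb, hab, Real.toNNReal_one])
    rwa [Real.coe_toNNReal a ha, Real.coe_toNNReal b hb] at this
  have hconvS : Convex ℝ {x : ℝ | φ x ≠ ⊤} := by
    intro u hu v hv a b ha hb hab
    have := hconv' u v a b ha hb hab
    refine ne_top_of_le_ne_top ?_ this
    exact ENNReal.add_ne_top.2 ⟨ENNReal.mul_ne_top ENNReal.ofReal_ne_top hu,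
      ENNReal.mul_ne_top ENNReal.ofReal_ne_top hv⟩
  have key : ∀ t ∈ Ico (0 : ℝ) 1, c / 2 * (t * (x - 1)) ^ 2 ≤ (φ x).toReal := by
    intro t ht
    have hin : 1 + t * (x - 1) ∈ interior {x : ℝ | φ x ≠ ⊤} := by
      have := hconvS.combo_interior_self_mem_interior hdom hx (a := 1 - t) (b := t)
        (by linarith [ht.2]) ht.1 (by ring)
      simp only [smul_eq_mul] at this
      convert this using 1
      ring
    have hle : φ (1 + t * (x - 1)) ≤ φ x := by
      have := hconv' 1 x (1 - t) t (by linarith [ht.2]) ht.1 (by ring)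
      rw [hone, mul_zero, zero_add] at this
      have h2 : ENNReal.ofReal t * φ x ≤ 1 * φ x := by
        gcongr
        exact ENNReal.ofReal_le_one.2 ht.2.le
      rw [one_mul] at h2
      refine le_trans (le_of_eq ?_) (this.trans h2)
      congr 1
      ring
    have hT := aux_taylor (fun y => (φ y).toReal) d1 d2 _ hconvS.interior hdom
      (fun _ => ENNReal.toReal_nonneg) (by simp [hone]) hd1 hd2 c (1 + t * (x - 1)) hin ?_
    · have h3 := ENNReal.toReal_mono hx hle
      simp only [add_sub_cancel_left] at hT
      linarith
    · intro s hs
      have hst : s * t ∈ Icc (0 : ℝ) 1 :=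
        ⟨mul_nonneg hs.1 ht.1, mul_le_one₀ hs.2 ht.1 ht.2.le⟩
      have h := hc (s * t) hst ?_
      · convert h using 2
        ring
      · have := hconvS.interior hdom hin (a := 1 - s) (b := s) (by linarith [hs.2]) hs.1 (by ring)
        simp only [smul_eq_mul] at this
        convert this using 1
        ring
  have hlim : Tendsto (fun t : ℝ => c / 2 * (t * (x - 1)) ^ 2) (𝓝[<] 1)
      (𝓝 (c / 2 * (1 * (x - 1)) ^ 2)) := by
    apply Tendsto.mono_left _ nhdsWithin_le_nhds
    exact Continuous.tendsto (by fun_prop) 1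
  have : c / 2 * (1 * (x - 1)) ^ 2 ≤ (φ x).toReal := by
    refine le_of_tendsto hlim ?_
    filter_upwards [Ico_mem_nhdsLT (zero_lt_one (α := ℝ))] with t ht using key t ht
  rw [one_mul] at this
  exact ENNReal.ofReal_le_of_le_toReal this

section
variable {Ω : Type*} [MeasurableSpace Ω]

theorem aux_cs (ν : Measure Ω) [IsProbabilityMeasure ν] (f : Ω → ℝ≥0∞) (hf : Measurable f) :
    (∫⁻ ω, f ω ∂ν) ^ 2 ≤ ∫⁻ ω, f ω ^ 2 ∂ν := by
  have h := ENNReal.lintegral_mul_le_Lp_mul_Lq ν (p := 2) (q := 2)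
    (by constructor <;> norm_num) hf.aemeasurable (g := fun _ => 1) aemeasurable_const
  simp at h
  calc (∫⁻ ω, f ω ∂ν) ^ 2 ≤ ((∫⁻ ω, f ω ^ 2 ∂ν) ^ (2⁻¹ : ℝ)) ^ 2 := by gcongr
    _ = _ := by
      rw [← ENNReal.rpow_natCast, ← ENNReal.rpow_mul]; simp

theorem aux_half (μ ν : Measure Ω) [IsProbabilityMeasure μ] [IsProbabilityMeasure ν]
    (h : Ω → ℝ) (hm : Measurable h) (h0 : ∀ ω, 0 ≤ h ω) (h2 : ∀ ω, h ω ≤ 2) :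
    ∫ ω, h ω ∂ν - ∫ ω, h ω ∂μ ≤ 2 * ∫ ω, max (1 - (μ.rnDeriv ν ω).toReal) 0 ∂ν := by
  have hb : ∀ ω, ‖h ω‖ ≤ 2 := fun ω => by
    rw [Real.norm_eq_abs, abs_of_nonneg (h0 ω)]; exact h2 ω
  have hiν : Integrable h ν := Integrable.of_bound hm.aestronglyMeasurable 2 (ae_of_all _ hb)
  have hiμ : Integrable h μ := Integrable.of_bound hm.aestronglyMeasurable 2 (ae_of_all _ hb)
  have hp : Integrable (fun ω => (μ.rnDeriv ν ω).toReal) ν := Measure.integrable_toReal_rnDeriv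
  have hph : Integrable (fun ω => (μ.rnDeriv ν ω).toReal * h ω) ν :=
    hp.mul_bdd (c := 2) hm.aestronglyMeasurable (ae_of_all _ hb)
  have hle : ∫ ω, (μ.rnDeriv ν ω).toReal * h ω ∂ν ≤ ∫ ω, h ω ∂μ := by
    have e : ∫ ω, (μ.rnDeriv ν ω).toReal * h ω ∂ν
        = ∫ ω, h ω ∂(ν.withDensity (μ.rnDeriv ν)) := by
      rw [integral_withDensity_eq_integral_toReal_smul (Measure.measurable_rnDeriv μ ν)
        (Measure.rnDeriv_lt_top μ ν)]
      simp
    rw [e]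
    exact integral_mono_measure (Measure.withDensity_rnDeriv_le μ ν) (ae_of_all _ h0) hiμ
  have hmx : Integrable (fun ω => max (1 - (μ.rnDeriv ν ω).toReal) 0) ν :=
    ((integrable_const 1).sub hp).pos_part
  have : ∫ ω, (h ω - (μ.rnDeriv ν ω).toReal * h ω) ∂ν
      ≤ ∫ ω, 2 * max (1 - (μ.rnDeriv ν ω).toReal) 0 ∂ν := by
    refine integral_mono (hiν.sub hph) (hmx.const_mul 2) fun ω => ?_
    have a1 := le_max_left (1 - (μ.rnDeriv ν ω).toReal) 0
    have a2 := le_max_right (1 - (μ.rnDeriv ν ω).toReal) 0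
    simp only
    nlinarith [h0 ω, h2 ω]
  rw [integral_sub hiν hph, integral_const_mul] at this
  linarith

theorem aux_tv (μ ν : Measure Ω) [IsProbabilityMeasure μ] [IsProbabilityMeasure ν] :
    0 ≤ tvDist μ ν ∧
    tvDist μ ν ≤ 2 * ∫ ω, max (1 - (μ.rnDeriv ν ω).toReal) 0 ∂ν := by
  constructor
  · apply Real.sSup_nonneg
    rintro r ⟨g, -, -, rfl⟩
    exact abs_nonneg _
  · refine csSup_le ⟨_, fun _ => 0, measurable_const, by simp, rfl⟩ ?_
    rintro r ⟨g, hg, hb, rfl⟩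
    have hb' : ∀ ω, ‖g ω‖ ≤ 1 := hb
    have iν : Integrable g ν := Integrable.of_bound hg.aestronglyMeasurable 1 (ae_of_all _ hb')
    have iμ : Integrable g μ := Integrable.of_bound hg.aestronglyMeasurable 1 (ae_of_all _ hb')
    have A := aux_half μ ν (fun ω => 1 - g ω) (by fun_prop)
      (fun ω => by linarith [(abs_le.1 (hb ω)).2]) (fun ω => by linarith [(abs_le.1 (hb ω)).1])
    have B := aux_half μ ν (fun ω => 1 + g ω) (by fun_prop)
      (fun ω => by linarith [(abs_le.1 (hb ω)).1]) (fun ω => by linarith [(abs_le.1 (hb ω)).2])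
    rw [integral_sub (integrable_const _) iν, integral_sub (integrable_const _) iμ] at A
    rw [integral_add (integrable_const _) iν, integral_add (integrable_const _) iμ] at B
    simp at A B
    rw [abs_le]
    constructor <;> linarith

theorem aux_final (μ ν : Measure Ω) [IsProbabilityMeasure μ] [IsProbabilityMeasure ν]
    (φ : ℝ → ℝ≥0∞) (c : ℝ) (hc : 0 < c) (f : Ω → ℝ) (hf : Measurable f) (hf0 : ∀ ω, 0 ≤ f ω)
    (hfi : Integrable f ν) (htv : tvDist μ ν ≤ 2 * ∫ ω, f ω ∂ν)
    (hφ : ∀ ω, ENNReal.ofReal (c / 2 * f ω ^ 2) ≤ φ ((μ.rnDeriv ν ω).toReal)) :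
    ENNReal.ofReal (c / 8 * tvDist μ ν ^ 2) ≤ ∫⁻ ω, φ ((μ.rnDeriv ν ω).toReal) ∂ν := by
  have h0 := (aux_tv μ ν).1
  calc ENNReal.ofReal (c / 8 * tvDist μ ν ^ 2)
      ≤ ENNReal.ofReal (c / 2 * (∫ ω, f ω ∂ν) ^ 2) := by
        apply ENNReal.ofReal_le_ofReal
        have : tvDist μ ν ^ 2 ≤ (2 * ∫ ω, f ω ∂ν) ^ 2 := by gcongr
        nlinarith
    _ = ENNReal.ofReal (c / 2) * (∫⁻ ω, ENNReal.ofReal (f ω) ∂ν) ^ 2 := by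
        rw [ENNReal.ofReal_mul (by positivity), ENNReal.ofReal_pow (integral_nonneg hf0),
          ofReal_integral_eq_lintegral_ofReal hfi (ae_of_all _ hf0)]
    _ ≤ ENNReal.ofReal (c / 2) * ∫⁻ ω, ENNReal.ofReal (f ω) ^ 2 ∂ν := by
        gcongr
        exact aux_cs ν _ (by fun_prop)
    _ = ∫⁻ ω, ENNReal.ofReal (c / 2 * f ω ^ 2) ∂ν := by
        rw [← lintegral_const_mul _ (by fun_prop)]
        congr 1
        ext ω
        rw [ENNReal.ofReal_mul (by positivity), ENNReal.ofReal_pow (hf0 ω)]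
    _ ≤ _ := lintegral_mono hφ

end

/-- **A Pinsker-type inequality under monotonicity of `φ''`.**  If `φ` is twice
differentiable on the interior of its domain (with first and second derivatives `dphi1`
and `ddphi1` there) and `φ''` is monotone on the interior of the domain, then for all
probability measures `μ, ν`:  `D_φ(μ‖ν) ≥ (φ''(1)/8) · TV(μ,ν)²`. -/
theorem pinsker_of_monotone_second_derivative {Ω : Type*} [MeasurableSpace Ω]
    (φ : ℝ → ℝ≥0∞)
    (hconv : ∀ x y : ℝ, ∀ a b : ℝ≥0, a + b = 1 →
      φ ((a : ℝ) * x + (b : ℝ) * y) ≤ (a : ℝ≥0∞) * φ x + (b : ℝ≥0∞) * φ y)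
    (hlsc : LowerSemicontinuous φ)
    (hneg : ∀ x : ℝ, x < 0 → φ x = ⊤)
    (hone : φ 1 = 0)
    (hdom : (1 : ℝ) ∈ interior {x : ℝ | φ x ≠ ⊤})
    (dphi : ℝ≥0∞)
    (hdphi : Tendsto (fun x : ℝ => φ x / ENNReal.ofReal x) atTop (𝓝 dphi))
    (dphi1 ddphi1 : ℝ → ℝ)
    (hd1 : ∀ x ∈ interior {x : ℝ | φ x ≠ ⊤},
      HasDerivAt (fun y : ℝ => (φ y).toReal) (dphi1 x) x)
    (hd2 : ∀ x ∈ interior {x : ℝ | φ x ≠ ⊤}, HasDerivAt dphi1 (ddphi1 x) x)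
    (hmono : MonotoneOn ddphi1 (interior {x : ℝ | φ x ≠ ⊤})
      ∨ AntitoneOn ddphi1 (interior {x : ℝ | φ x ≠ ⊤}))
    (μ ν : Measure Ω) [IsProbabilityMeasure μ] [IsProbabilityMeasure ν] :
    ENNReal.ofReal (ddphi1 1 / 8 * tvDist μ ν ^ 2) ≤ divFull φ dphi μ ν := by
  rcases le_or_gt (ddphi1 1) 0 with hc | hc
  · rw [ENNReal.ofReal_of_nonpos]
    · exact zero_le
    · exact mul_nonpos_of_nonpos_of_nonneg (by linarith) (sq_nonneg _)
  have hp : Integrable (fun ω => (μ.rnDeriv ν ω).toReal) ν := Measure.integrable_toReal_rnDeriv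
  have hpm : Measurable (fun ω => (μ.rnDeriv ν ω).toReal) :=
    (Measure.measurable_rnDeriv μ ν).ennreal_toReal
  have i1 : Integrable (fun ω => max (1 - (μ.rnDeriv ν ω).toReal) 0) ν :=
    ((integrable_const 1).sub hp).pos_part
  have i2 : Integrable (fun ω => max ((μ.rnDeriv ν ω).toReal - 1) 0) ν :=
    (hp.sub (integrable_const 1)).pos_part
  unfold divFull
  rcases hmono with hmono | hmono
  · have hb : ∀ x : ℝ, 1 ≤ x → ENNReal.ofReal (ddphi1 1 / 2 * (x - 1) ^ 2) ≤ φ x := by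
      intro x hx
      refine aux_bound φ hconv hone hdom dphi1 ddphi1 hd1 hd2 _ x fun t ht hI => ?_
      exact hmono hdom hI (by nlinarith [ht.1])
    have htop : dphi = ⊤ := by
      have hT : Tendsto (fun x : ℝ => ENNReal.ofReal (ddphi1 1 / 2 * (x - 2))) atTop (𝓝 ⊤) := by
        refine ENNReal.tendsto_ofReal_atTop.comp ?_
        refine Tendsto.const_mul_atTop (by positivity) ?_
        exact tendsto_atTop_add_const_right _ (-2) tendsto_id
      refine top_le_iff.1 (le_of_tendsto_of_tendsto hT hdphi ?_)
      filter_upwards [eventually_ge_atTop (1 : ℝ)] with x hx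
      rw [ENNReal.le_div_iff_mul_le (Or.inl (by simp; linarith)) (Or.inl (by simp)),
        ← ENNReal.ofReal_mul' (by linarith)]
      refine le_trans (ENNReal.ofReal_le_ofReal ?_) (hb x hx)
      nlinarith
    by_cases hs : μ.singularPart ν Set.univ = 0
    · have hac : μ ≪ ν := by
        rw [← Measure.singularPart_eq_zero]
        exact Measure.measure_univ_eq_zero.1 hs
      have hint : ∫ ω, (μ.rnDeriv ν ω).toReal ∂ν = 1 := by
        rw [Measure.integral_toReal_rnDeriv hac]; simp
      have heq : ∫ ω, max (1 - (μ.rnDeriv ν ω).toReal) 0 ∂ν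
          = ∫ ω, max ((μ.rnDeriv ν ω).toReal - 1) 0 ∂ν := by
        rw [← sub_eq_zero, ← integral_sub i1 i2]
        have : ∀ ω, max (1 - (μ.rnDeriv ν ω).toReal) 0 - max ((μ.rnDeriv ν ω).toReal - 1) 0
            = 1 - (μ.rnDeriv ν ω).toReal := by
          intro ω
          rcases le_total (μ.rnDeriv ν ω).toReal 1 with h | h
          · rw [max_eq_left (by linarith), max_eq_right (by linarith)]; ring
          · rw [max_eq_right (by linarith), max_eq_left (by linarith)]; ring
        simp only [this]
        rw [integral_sub (integrable_const _) hp, hint]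
        simp
      refine le_trans ?_ le_self_add
      refine aux_final μ ν φ _ hc (fun ω => max ((μ.rnDeriv ν ω).toReal - 1) 0)
        (by fun_prop) (fun ω => le_max_right _ _) i2 (heq ▸ (aux_tv μ ν).2) fun ω => ?_
      rcases le_total 1 (μ.rnDeriv ν ω).toReal with h | h
      · simp only [max_eq_left (sub_nonneg.2 h)]
        exact hb _ h
      · simp [max_eq_right (sub_nonpos.2 h)]
    · rw [htop, ENNReal.top_mul hs]
      simp
  · have hb : ∀ x : ℝ, x ≤ 1 → ENNReal.ofReal (ddphi1 1 / 2 * (x - 1) ^ 2) ≤ φ x := by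
      intro x hx
      refine aux_bound φ hconv hone hdom dphi1 ddphi1 hd1 hd2 _ x fun t ht hI => ?_
      exact hmono hI hdom (by nlinarith [ht.1])
    refine le_trans ?_ le_self_add
    refine aux_final μ ν φ _ hc (fun ω => max (1 - (μ.rnDeriv ν ω).toReal) 0)
      (by fun_prop) (fun ω => le_max_right _ _) i1 (aux_tv μ ν).2 fun ω => ?_
    rcases le_total (μ.rnDeriv ν ω).toReal 1 with h | h
    · simp only [max_eq_left (sub_nonneg.2 h)]
      refine le_trans (le_of_eq ?_) (hb _ h)
      congr 2
      ring
    · simp [max_eq_right (sub_nonpos.2 h)]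
end

section
/- Suppose φ is strictly convex and twice differentiable on the interior of its domain, thrice differentiable at 1 with φ''(1) > 0, and satisfies 27·φ''(1) / (3 − z·φ'''(1)/φ''(1))³ ≤ φ''(1+z) for every z ≥ −1 with 1+z in the interior of dom φ. Then for all probability measures μ, ν on any measurable space (Ω,F): D_φ(μ‖ν) ≥ (φ''(1)/2) · TV(μ,ν)². (Pinsker-type inequality with the best possible constant.) -/
open MeasureTheory Filter Set
open scoped ENNReal NNReal Topology

lemma pinsker_psi_d1 (c α x : ℝ) (hw : 3 - α * (x - 1) ≠ 0) :
    HasDerivAt (fun x : ℝ => 3 * c / 2 * (x - 1) ^ 2 / (3 - α * (x - 1)))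
      (3 * c / 2 * ((x - 1) * (6 - α * (x - 1))) / (3 - α * (x - 1)) ^ 2) x := by
  have hz : HasDerivAt (fun x : ℝ => x - 1) 1 x := (hasDerivAt_id x).sub_const 1
  have h := ((hz.pow 2).const_mul (3 * c / 2)).div ((hz.const_mul α).const_sub 3) hw
  refine h.congr_deriv ?_
  simp only [Pi.pow_apply]
  field_simp
  push_cast
  ring

lemma pinsker_psi_d2 (c α x : ℝ) (hw : 3 - α * (x - 1) ≠ 0) :
    HasDerivAt (fun x : ℝ => 3 * c / 2 * ((x - 1) * (6 - α * (x - 1))) / (3 - α * (x - 1)) ^ 2)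
      (27 * c / (3 - α * (x - 1)) ^ 3) x := by
  have hz : HasDerivAt (fun x : ℝ => x - 1) 1 x := (hasDerivAt_id x).sub_const 1
  have h := ((hz.mul ((hz.const_mul α).const_sub 6)).const_mul (3 * c / 2)).div
    (((hz.const_mul α).const_sub 3).pow 2) (pow_ne_zero 2 hw)
  refine h.congr_deriv ?_
  simp only [Pi.pow_apply, Pi.mul_apply]
  field_simp
  push_cast
  ring

lemma pinsker_real_bound (I : Set ℝ) (hIo : IsOpen I) (hIc : Convex ℝ I) (h1 : (1 : ℝ) ∈ I)
    (F F1 F2 : ℝ → ℝ) (c α : ℝ) (hF1 : F 1 = 0) (hF11 : F1 1 = 0)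
    (hd1 : ∀ x ∈ I, HasDerivAt F (F1 x) x) (hd2 : ∀ x ∈ I, HasDerivAt F1 (F2 x) x)
    (hineq : ∀ x ∈ I, 27 * c / (3 - α * (x - 1)) ^ 3 ≤ F2 x)
    (x : ℝ) (hx : x ∈ I) (hw : 0 < 3 - α * (x - 1)) :
    3 * c / 2 * (x - 1) ^ 2 ≤ F x * (3 - α * (x - 1)) := by
  set J : Set ℝ := I ∩ {x | 0 < 3 - α * (x - 1)} with hJ
  have hopen : IsOpen {x : ℝ | 0 < 3 - α * (x - 1)} :=
    isOpen_lt continuous_const (by fun_prop)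
  have hJo : IsOpen J := hIo.inter hopen
  have hJc : Convex ℝ J := by
    refine hIc.inter ?_
    intro a ha b hb s t hs ht hst
    simp only [mem_ofPred_eq, smul_eq_mul] at *
    have : 3 - α * (s * a + t * b - 1) = s * (3 - α * (a - 1)) + t * (3 - α * (b - 1)) := by
      have : t = 1 - s := by linarith
      subst this; ring
    rw [this]
    rcases hs.eq_or_lt with h | h
    · have : t = 1 := by linarith
      rw [← h, this]; linarith
    · have := mul_pos h ha
      have := mul_nonneg ht hb.le
      linarith
  have hJ1 : (1 : ℝ) ∈ J := ⟨h1, by simp⟩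
  have hG1 : ∀ y ∈ J, HasDerivAt
      (fun x => F x - 3 * c / 2 * (x - 1) ^ 2 / (3 - α * (x - 1)))
      (F1 y - 3 * c / 2 * ((y - 1) * (6 - α * (y - 1))) / (3 - α * (y - 1)) ^ 2) y :=
    fun y hy => (hd1 y hy.1).sub (pinsker_psi_d1 c α y (ne_of_gt hy.2))
  have hG2 : ∀ y ∈ J, HasDerivAt
      (fun y => F1 y - 3 * c / 2 * ((y - 1) * (6 - α * (y - 1))) / (3 - α * (y - 1)) ^ 2)
      (F2 y - 27 * c / (3 - α * (y - 1)) ^ 3) y :=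
    fun y hy => (hd2 y hy.1).sub (pinsker_psi_d2 c α y (ne_of_gt hy.2))
  have hconv : ConvexOn ℝ J (fun x => F x - 3 * c / 2 * (x - 1) ^ 2 / (3 - α * (x - 1))) := by
    refine convexOn_of_hasDerivWithinAt2_nonneg hJc
      (fun y hy => (hG1 y hy).continuousAt.continuousWithinAt)
      (f' := fun y => F1 y - 3 * c / 2 * ((y - 1) * (6 - α * (y - 1))) / (3 - α * (y - 1)) ^ 2)
      (f'' := fun y => F2 y - 27 * c / (3 - α * (y - 1)) ^ 3) ?_ ?_ ?_
    · intro y hy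
      exact (hG1 y (interior_subset hy)).hasDerivWithinAt
    · intro y hy
      exact (hG2 y (interior_subset hy)).hasDerivWithinAt
    · intro y hy
      exact sub_nonneg.2 (hineq y (interior_subset hy).1)
  have hxJ : x ∈ J := ⟨hx, hw⟩
  have hd := hG1 1 hJ1
  simp only [hF11, sub_self, zero_mul, mul_zero, zero_div] at hd
  have key : 0 ≤ F x - 3 * c / 2 * (x - 1) ^ 2 / (3 - α * (x - 1)) := by
    rcases lt_trichotomy x 1 with h | h | h
    · have := hconv.slope_le_of_hasDerivAt hxJ hJ1 h hd
      rw [slope_def_field, div_le_iff₀ (by linarith)] at this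
      simp [hF1] at this
      linarith
    · simp [h, hF1]
    · have := hconv.le_slope_of_hasDerivAt hJ1 hxJ h hd
      rw [slope_def_field, le_div_iff₀ (by linarith)] at this
      simp [hF1] at this
      linarith
  rw [sub_nonneg, div_le_iff₀ hw] at key
  exact key

lemma pinsker_real_pos (I : Set ℝ) (hIo : IsOpen I) (hIc : Convex ℝ I) (h1 : (1 : ℝ) ∈ I)
    (F F1 F2 : ℝ → ℝ) (c α : ℝ) (hc : 0 < c) (hF1 : F 1 = 0) (hF11 : F1 1 = 0)
    (hd1 : ∀ x ∈ I, HasDerivAt F (F1 x) x) (hd2 : ∀ x ∈ I, HasDerivAt F1 (F2 x) x)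
    (hineq : ∀ x ∈ I, 27 * c / (3 - α * (x - 1)) ^ 3 ≤ F2 x)
    (x : ℝ) (hx : x ∈ I) : 0 < 3 - α * (x - 1) := by
  by_contra hcon
  push Not at hcon
  set q := α * (x - 1) with hq
  have hq3 : 3 ≤ q := by linarith
  have hq0 : 0 < q := by linarith
  set T := 3 / q with hT
  have hT0 : 0 < T := by positivity
  have hT1 : T ≤ 1 := (div_le_one hq0).2 hq3
  have hmem : ∀ t ∈ Set.Icc (0:ℝ) 1, 1 + t * (x - 1) ∈ I := by
    intro t ht
    have := hIc h1 hx (a := 1 - t) (b := t) (by linarith [ht.2]) ht.1 (by ring)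
    convert this using 1
    simp only [smul_eq_mul]; ring
  have hb : ∀ t ∈ Set.Ico 0 T, 3 * c / 2 * (t * (x - 1)) ^ 2 ≤
      F (1 + t * (x - 1)) * (3 - t * q) := by
    intro t ht
    have hw : 0 < 3 - t * q := by
      have := ht.2
      rw [hT, lt_div_iff₀ hq0] at this
      linarith
    have := pinsker_real_bound I hIo hIc h1 F F1 F2 c α hF1 hF11 hd1 hd2 hineq
      (1 + t * (x - 1)) (hmem t ⟨ht.1, by linarith [ht.2]⟩) (by
        have e : 3 - α * (1 + t * (x - 1) - 1) = 3 - t * q := by rw [hq]; ring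
        rw [e]; exact hw)
    have e : 3 - α * (1 + t * (x - 1) - 1) = 3 - t * q := by rw [hq]; ring
    rw [e] at this
    convert this using 3
    ring
  have hTmem := hmem T ⟨hT0.le, hT1⟩
  have hcont : ContinuousAt (fun t => F (1 + t * (x - 1)) * (3 - t * q)) T := by
    refine ContinuousAt.mul ?_ (by fun_prop)
    exact ContinuousAt.comp (f := fun t : ℝ => 1 + t * (x - 1)) (g := F)
      (hd1 _ hTmem).continuousAt (by fun_prop)
  have hcl : T ∈ closure (Set.Ico 0 T) := by
    rw [closure_Ico hT0.ne]; exact ⟨hT0.le, le_rfl⟩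
  have hlim := ContinuousWithinAt.closure_le hcl
    (f := fun t => 3 * c / 2 * (t * (x - 1)) ^ 2)
    (by fun_prop) hcont.continuousWithinAt hb
  have e : 3 - T * q = 0 := by rw [hT]; field_simp; ring
  simp only [e, mul_zero] at hlim
  have hx1 : x - 1 ≠ 0 := by
    intro h; rw [h, mul_zero] at hq; linarith
  have : 0 < 3 * c / 2 * (T * (x - 1)) ^ 2 := by positivity
  linarith

lemma pinsker_real_lin (I : Set ℝ) (hIo : IsOpen I) (hIc : Convex ℝ I) (h1 : (1 : ℝ) ∈ I)
    (F F1 F2 : ℝ → ℝ) (c α : ℝ) (hc : 0 < c) (hF1 : F 1 = 0) (hF11 : F1 1 = 0)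
    (hd1 : ∀ x ∈ I, HasDerivAt F (F1 x) x) (hd2 : ∀ x ∈ I, HasDerivAt F1 (F2 x) x)
    (hineq : ∀ x ∈ I, 27 * c / (3 - α * (x - 1)) ^ 3 ≤ F2 x) (l : ℝ)
    (x : ℝ) (hx : x ∈ I) :
    3 * c / 2 * (2 * l * |x - 1| - l ^ 2 * (3 - α * (x - 1))) ≤ F x := by
  have hw := pinsker_real_pos I hIo hIc h1 F F1 F2 c α hc hF1 hF11 hd1 hd2 hineq x hx
  have hb := pinsker_real_bound I hIo hIc h1 F F1 F2 c α hF1 hF11 hd1 hd2 hineq x hx hw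
  set w := 3 - α * (x - 1)
  rw [← sq_abs] at hb
  refine le_of_mul_le_mul_right ?_ hw
  have := mul_nonneg (by positivity : 0 ≤ 3 * c / 2) (sq_nonneg (|x - 1| - l * w))
  nlinarith

lemma pinsker_phi_lin (φ : ℝ → ℝ≥0∞)
    (hconv : ∀ x y : ℝ, ∀ a b : ℝ≥0, a + b = 1 →
      φ ((a : ℝ) * x + (b : ℝ) * y) ≤ (a : ℝ≥0∞) * φ x + (b : ℝ≥0∞) * φ y)
    (hneg : ∀ x : ℝ, x < 0 → φ x = ⊤)
    (hone : φ 1 = 0)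
    (hdom : (1 : ℝ) ∈ interior {x : ℝ | φ x ≠ ⊤})
    (dphi1 ddphi1 : ℝ → ℝ)
    (hd1 : ∀ x ∈ interior {x : ℝ | φ x ≠ ⊤},
      HasDerivAt (fun y : ℝ => (φ y).toReal) (dphi1 x) x)
    (hd2 : ∀ x ∈ interior {x : ℝ | φ x ≠ ⊤}, HasDerivAt dphi1 (ddphi1 x) x)
    (d3 : ℝ)
    (hpos : 0 < ddphi1 1)
    (hineq : ∀ z : ℝ, -1 ≤ z → (1 + z) ∈ interior {x : ℝ | φ x ≠ ⊤} →
      27 * ddphi1 1 / (3 - z * d3 / ddphi1 1) ^ 3 ≤ ddphi1 (1 + z)) (l : ℝ) (x : ℝ) :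
    ENNReal.ofReal (3 * ddphi1 1 / 2 *
      (2 * l * |x - 1| - l ^ 2 * (3 - d3 / ddphi1 1 * (x - 1)))) ≤ φ x := by
  by_cases hx : φ x = ⊤
  · rw [hx]; exact le_top
  have hDc : Convex ℝ {x : ℝ | φ x ≠ ⊤} := by
    intro x hx y hy a b ha hb hab
    have := hconv x y ⟨a, ha⟩ ⟨b, hb⟩ (NNReal.eq hab)
    refine ne_top_of_le_ne_top ?_ this
    exact ENNReal.add_ne_top.2 ⟨ENNReal.mul_ne_top ENNReal.coe_ne_top hx,
      ENNReal.mul_ne_top ENNReal.coe_ne_top hy⟩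
  have hF11 : dphi1 1 = 0 := by
    refine IsLocalMin.hasDerivAt_eq_zero (f := fun y : ℝ => (φ y).toReal) ?_ (hd1 1 hdom)
    refine Filter.Eventually.of_forall fun y => ?_
    simp [hone]
  have hlin := pinsker_real_lin (interior {x : ℝ | φ x ≠ ⊤}) isOpen_interior hDc.interior hdom
    (fun y : ℝ => (φ y).toReal) dphi1 ddphi1 (ddphi1 1) (d3 / ddphi1 1) hpos (by simp [hone])
    hF11 hd1 hd2 (by
      intro y hy
      have hy0 : 0 ≤ y := by
        by_contra h
        exact interior_subset hy (hneg y (not_le.1 h))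
      have := hineq (y - 1) (by linarith) (by simpa using hy)
      rw [add_sub_cancel] at this
      convert this using 4
      ring) l
  refine ENNReal.ofReal_le_of_le_toReal ?_
  have hb : ∀ t ∈ Set.Ioo (0:ℝ) 1, 3 * ddphi1 1 / 2 *
      (2 * l * |t * (x - 1)| - l ^ 2 * (3 - d3 / ddphi1 1 * (t * (x - 1)))) ≤
      t * (φ x).toReal := by
    intro t ht
    have hm : 1 + t * (x - 1) ∈ interior {x : ℝ | φ x ≠ ⊤} := by
      have := hDc.combo_interior_self_mem_interior hdom hx (a := 1 - t) (b := t)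
        (by linarith [ht.2]) ht.1.le (by ring)
      convert this using 1
      simp only [smul_eq_mul]; ring
    have h1 := hlin _ hm
    rw [add_sub_cancel_left] at h1
    refine h1.trans ?_
    have h2 := hconv 1 x ⟨1 - t, by linarith [ht.2]⟩ ⟨t, ht.1.le⟩
      (NNReal.eq (sub_add_cancel (1 : ℝ) t))
    rw [hone, mul_zero, zero_add] at h2
    have h3 := ENNReal.toReal_mono (ENNReal.mul_ne_top ENNReal.coe_ne_top hx) h2
    rw [ENNReal.toReal_mul] at h3
    have e : 1 + t * (x - 1) = (1 - t) * 1 + t * x := by ring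
    rw [e]
    exact h3
  have hcl : (1:ℝ) ∈ closure (Set.Ioo (0:ℝ) 1) := by
    rw [closure_Ioo (by norm_num)]; simp
  have hlim := ContinuousWithinAt.closure_le hcl
    (f := fun t : ℝ => 3 * ddphi1 1 / 2 *
      (2 * l * |t * (x - 1)| - l ^ 2 * (3 - d3 / ddphi1 1 * (t * (x - 1)))))
    (g := fun t : ℝ => t * (φ x).toReal)
    (by fun_prop) (by fun_prop) hb
  simpa using hlim

lemma pinsker_dphi_lin (φ : ℝ → ℝ≥0∞) (dphi : ℝ≥0∞)
    (hdphi : Tendsto (fun x : ℝ => φ x / ENNReal.ofReal x) atTop (𝓝 dphi)) (C l α : ℝ)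
    (h : ∀ x, ENNReal.ofReal (C * (2 * l * |x - 1| - l ^ 2 * (3 - α * (x - 1)))) ≤ φ x) :
    ENNReal.ofReal (C * (2 * l + l ^ 2 * α)) ≤ dphi := by
  have hlim : Tendsto (fun x : ℝ => ENNReal.ofReal
      (C * (2 * l + l ^ 2 * α) - C * (2 * l + l ^ 2 * α + 3 * l ^ 2) * x⁻¹)) atTop
      (𝓝 (ENNReal.ofReal (C * (2 * l + l ^ 2 * α)))) := by
    refine ENNReal.tendsto_ofReal ?_
    have := (tendsto_inv_atTop_zero (𝕜 := ℝ)).const_mul (C * (2 * l + l ^ 2 * α + 3 * l ^ 2))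
    simpa using this.const_sub (C * (2 * l + l ^ 2 * α))
  refine le_of_tendsto_of_tendsto hlim hdphi ?_
  filter_upwards [eventually_ge_atTop 1] with x hx
  have hx0 : 0 < x := by linarith
  have := h x
  rw [abs_of_nonneg (by linarith)] at this
  refine le_trans (le_of_eq ?_) (ENNReal.div_le_div_right this _)
  rw [← ENNReal.ofReal_div_of_pos hx0]
  congr 1
  field_simp
  ring

lemma pinsker_ofReal_integral_le {Ω : Type*} [MeasurableSpace Ω] (ν : Measure Ω) (f : Ω → ℝ)
    (hf : Integrable f ν) :
    ENNReal.ofReal (∫ ω, f ω ∂ν) ≤ ∫⁻ ω, ENNReal.ofReal (f ω) ∂ν := by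
  refine ENNReal.ofReal_le_of_le_toReal ?_
  rw [integral_eq_lintegral_pos_part_sub_lintegral_neg_part hf]
  linarith [ENNReal.toReal_nonneg (a := ∫⁻ ω, ENNReal.ofReal (-f ω) ∂ν)]

lemma pinsker_tv_le {Ω : Type*} [MeasurableSpace Ω] (μ ν : Measure Ω)
    [IsProbabilityMeasure μ] [IsProbabilityMeasure ν] :
    tvDist μ ν ≤ ∫ ω, |(μ.rnDeriv ν ω).toReal - 1| ∂ν + (μ.singularPart ν).real univ := by
  have hi : Integrable (fun ω => (μ.rnDeriv ν ω).toReal) ν := Measure.integrable_toReal_rnDeriv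
  refine Real.sSup_le ?_ (add_nonneg (integral_nonneg fun _ => abs_nonneg _) measureReal_nonneg)
  rintro r ⟨g, hg, hg1, rfl⟩
  have hgi : ∀ (m : Measure Ω) [IsFiniteMeasure m], Integrable g m := fun m _ =>
    Integrable.of_bound hg.aestronglyMeasurable 1 (Filter.Eventually.of_forall hg1)
  have hgf : Integrable (fun ω => (μ.rnDeriv ν ω).toReal * g ω) ν :=
    hi.mul_bdd (c := 1) hg.aestronglyMeasurable (Filter.Eventually.of_forall hg1)
  have e : ∫ ω, g ω ∂μ = ∫ ω, g ω ∂(μ.singularPart ν) + ∫ ω, (μ.rnDeriv ν ω).toReal * g ω ∂ν := by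
    conv_lhs => rw [← Measure.singularPart_add_rnDeriv μ ν]
    rw [integral_add_measure (hgi _) (hgi _),
      integral_withDensity_eq_integral_toReal_smul (Measure.measurable_rnDeriv μ ν)
        (Measure.rnDeriv_lt_top μ ν)]
    simp
  have e2 : ∫ ω, g ω ∂μ - ∫ ω, g ω ∂ν = ∫ ω, ((μ.rnDeriv ν ω).toReal - 1) * g ω ∂ν
      + ∫ ω, g ω ∂(μ.singularPart ν) := by
    simp only [sub_mul, one_mul]
    rw [integral_sub hgf (hgi ν), e]; ring
  rw [e2]
  refine (abs_add_le _ _).trans (add_le_add ?_ ?_)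
  · refine abs_integral_le_integral_abs.trans ?_
    refine integral_mono_of_nonneg (Filter.Eventually.of_forall fun _ => abs_nonneg _)
      (hi.sub (integrable_const 1)).abs (Filter.Eventually.of_forall fun ω => ?_)
    simp only [abs_mul]
    exact mul_le_of_le_one_right (abs_nonneg _) (hg1 ω)
  · have := norm_integral_le_of_norm_le_const (μ := μ.singularPart ν) (f := g) (C := 1)
      (Filter.Eventually.of_forall hg1)
    simpa using this

/-- **An optimal Pinsker-type inequality.**  Suppose `φ` is strictly convex and twice
differentiable on the interior of its domain, thrice differentiable at `1` with
`φ''(1) > 0`, and satisfies `27·φ''(1)/(3 − z·φ'''(1)/φ''(1))³ ≤ φ''(1+z)` for every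
`z ≥ −1` with `1 + z` in the interior of the domain.  Then for all probability measures
`μ, ν`:  `D_φ(μ‖ν) ≥ (φ''(1)/2) · TV(μ,ν)²`. -/
theorem pinsker_optimal_constant {Ω : Type*} [MeasurableSpace Ω]
    (φ : ℝ → ℝ≥0∞)
    (hconv : ∀ x y : ℝ, ∀ a b : ℝ≥0, a + b = 1 →
      φ ((a : ℝ) * x + (b : ℝ) * y) ≤ (a : ℝ≥0∞) * φ x + (b : ℝ≥0∞) * φ y)
    (hlsc : LowerSemicontinuous φ)
    (hneg : ∀ x : ℝ, x < 0 → φ x = ⊤)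
    (hone : φ 1 = 0)
    (hdom : (1 : ℝ) ∈ interior {x : ℝ | φ x ≠ ⊤})
    (dphi : ℝ≥0∞)
    (hdphi : Tendsto (fun x : ℝ => φ x / ENNReal.ofReal x) atTop (𝓝 dphi))
    (hstrict : StrictConvexOn ℝ (interior {x : ℝ | φ x ≠ ⊤}) (fun y : ℝ => (φ y).toReal))
    (dphi1 ddphi1 : ℝ → ℝ)
    (hd1 : ∀ x ∈ interior {x : ℝ | φ x ≠ ⊤},
      HasDerivAt (fun y : ℝ => (φ y).toReal) (dphi1 x) x)
    (hd2 : ∀ x ∈ interior {x : ℝ | φ x ≠ ⊤}, HasDerivAt dphi1 (ddphi1 x) x)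
    (d3 : ℝ) (hd3 : HasDerivAt ddphi1 d3 1)
    (hpos : 0 < ddphi1 1)
    (hineq : ∀ z : ℝ, -1 ≤ z → (1 + z) ∈ interior {x : ℝ | φ x ≠ ⊤} →
      27 * ddphi1 1 / (3 - z * d3 / ddphi1 1) ^ 3 ≤ ddphi1 (1 + z))
    (μ ν : Measure Ω) [IsProbabilityMeasure μ] [IsProbabilityMeasure ν] :
    ENNReal.ofReal (ddphi1 1 / 2 * tvDist μ ν ^ 2) ≤ divFull φ dphi μ ν := by
  have htv := pinsker_tv_le μ ν
  set V := tvDist μ ν with hV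
  have hV0 : 0 ≤ V := by
    refine Real.sSup_nonneg ?_
    rintro r ⟨g, -, -, rfl⟩
    exact abs_nonneg _
  have hlin := pinsker_phi_lin φ hconv hneg hone hdom dphi1 ddphi1 hd1 hd2 d3 hpos hineq (V / 3)
  have hdl := pinsker_dphi_lin φ dphi hdphi (3 * ddphi1 1 / 2) (V / 3) (d3 / ddphi1 1) hlin
  set c := ddphi1 1
  set α := d3 / c
  set s := (μ.singularPart ν).real univ with hs
  have hs0 : 0 ≤ s := measureReal_nonneg
  have hi : Integrable (fun ω => (μ.rnDeriv ν ω).toReal) ν := Measure.integrable_toReal_rnDeriv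
  have hi1 : Integrable (fun ω => (μ.rnDeriv ν ω).toReal - 1) ν := hi.sub (integrable_const 1)
  have hI : ∫ ω, ((μ.rnDeriv ν ω).toReal - 1) ∂ν = - s := by
    rw [integral_sub hi (integrable_const 1), Measure.integral_toReal_rnDeriv']
    simp [hs]
  set A := ∫ ω, |(μ.rnDeriv ν ω).toReal - 1| ∂ν with hA
  have hia : Integrable (fun ω => 2 * (V / 3) * |(μ.rnDeriv ν ω).toReal - 1|) ν :=
    hi1.abs.const_mul _
  have hib : Integrable (fun ω => 3 - α * ((μ.rnDeriv ν ω).toReal - 1)) ν :=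
    (integrable_const 3).sub (hi1.const_mul α)
  have hL : ∫ ω, 3 * c / 2 * (2 * (V / 3) * |(μ.rnDeriv ν ω).toReal - 1| -
      (V / 3) ^ 2 * (3 - α * ((μ.rnDeriv ν ω).toReal - 1))) ∂ν =
      3 * c / 2 * (2 * (V / 3) * A - (V / 3) ^ 2 * (3 + α * s)) := by
    rw [integral_const_mul, integral_sub hia (hib.const_mul _), integral_const_mul,
      integral_const_mul, integral_sub (integrable_const 3) (hi1.const_mul α),
      integral_const_mul, hI, ← hA]
    simp
  have h1 : ENNReal.ofReal (3 * c / 2 * (2 * (V / 3) * A - (V / 3) ^ 2 * (3 + α * s))) ≤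
      ∫⁻ ω, φ ((μ.rnDeriv ν ω).toReal) ∂ν := by
    rw [← hL]
    refine (pinsker_ofReal_integral_le ν _ ((hia.sub (hib.const_mul _)).const_mul _)).trans ?_
    exact lintegral_mono fun ω => hlin _
  have h2 : ENNReal.ofReal (3 * c / 2 * (2 * (V / 3) + (V / 3) ^ 2 * α) * s) ≤
      dphi * μ.singularPart ν univ := by
    rw [ENNReal.ofReal_mul' hs0, hs, ofReal_measureReal]
    gcongr
  refine le_trans ?_ (add_le_add h1 h2)
  refine le_trans (ENNReal.ofReal_le_ofReal ?_) ENNReal.ofReal_add_le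
  have : 0 ≤ c * V * (A + s - V) := mul_nonneg (mul_nonneg hpos.le hV0) (by linarith)
  nlinarith
end

section
/- Suppose φ is strictly convex on its domain, twice differentiable with φ''(x) > 0 for every x in the interior of its domain, the function 1/φ'' is concave on the interior of dom φ, and ψ*(x) → +∞ as x → φ'(∞) from the left (this last condition holds in particular whenever φ'(∞) = +∞). Then for all probability measures μ, ν on any measurable space (Ω,F): D_φ(μ‖ν) ≥ (φ''(1)/2) · TV(μ,ν)². -/
open MeasureTheory Filter Set
open scoped ENNReal NNReal Topology

lemma exists_supergradient {I : Set ℝ} (hI : IsOpen I) (h1 : (1 : ℝ) ∈ I) {h : ℝ → ℝ}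
    (hc : ConcaveOn ℝ I h) : ∃ c : ℝ, ∀ x ∈ I, h x ≤ h 1 + c * (x - 1) := by
  have hn : ConvexOn ℝ I (-h) := hc.neg
  have h1' : (1 : ℝ) ∈ interior I := by rwa [hI.interior_eq]
  refine ⟨-derivWithin (-h) (Ioi 1) 1, fun x hx => ?_⟩
  rcases lt_trichotomy x 1 with hlt | rfl | hgt
  · have a := hn.slope_le_leftDeriv_of_mem_interior hx h1' hlt
    have b := hn.leftDeriv_le_rightDeriv_of_mem_interior h1'
    have e := a.trans b
    rw [slope_def_field, div_le_iff₀ (by linarith)] at e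
    simp only [Pi.neg_apply] at e
    linarith
  · simp
  · have a := hn.rightDeriv_le_slope_of_mem_interior h1' hx hgt
    rw [slope_def_field, le_div_iff₀ (by linarith)] at a
    simp only [Pi.neg_apply] at a
    linarith

lemma compare_of_second_deriv {I : Set ℝ} (hIc : Convex ℝ I) (h1 : (1 : ℝ) ∈ I)
    {f f' f'' q q' q'' : ℝ → ℝ}
    (hf : ∀ x ∈ I, HasDerivAt f (f' x) x) (hf' : ∀ x ∈ I, HasDerivAt f' (f'' x) x)
    (hf1 : f 1 = 0) (hf1' : f' 1 = 0) {x : ℝ} (hx : x ∈ I)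
    (hq : ∀ s ∈ uIcc 1 x, HasDerivAt q (q' s) s) (hq' : ∀ s ∈ uIcc 1 x, HasDerivAt q' (q'' s) s)
    (hq1 : q 1 = 0) (hq1' : q' 1 = 0) (hle : ∀ s ∈ uIcc 1 x, q'' s ≤ f'' s) :
    q x ≤ f x := by
  have hsub : uIcc 1 x ⊆ I := by
    have := hIc.ordConnected
    exact this.uIcc_subset h1 hx
  have hcv : ConvexOn ℝ (uIcc 1 x) (fun s => f s - q s) := by
    refine convexOn_of_hasDerivWithinAt2_nonneg (convex_uIcc 1 x)
      (f' := fun s => f' s - q' s) (f'' := fun s => f'' s - q'' s) ?_ ?_ ?_ ?_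
    · intro s hs
      exact ((hf s (hsub hs)).sub (hq s hs)).continuousAt.continuousWithinAt
    · intro s hs
      have hs := interior_subset hs
      exact ((hf s (hsub hs)).sub (hq s hs)).hasDerivWithinAt
    · intro s hs
      have hs := interior_subset hs
      exact ((hf' s (hsub hs)).sub (hq' s hs)).hasDerivWithinAt
    · intro s hs
      have hs := interior_subset hs
      have := hle s hs
      linarith
  have hd : HasDerivAt (fun s => f s - q s) 0 1 := by
    have := (hf 1 h1).sub (hq 1 left_mem_uIcc)
    rw [hf1', hq1', sub_zero] at this
    exact this
  rcases lt_trichotomy x 1 with hlt | rfl | hgt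
  · have a := hcv.slope_le_of_hasDerivAt right_mem_uIcc left_mem_uIcc hlt hd
    rw [slope_def_field, div_le_iff₀ (by linarith)] at a
    linarith
  · linarith
  · have a := hcv.le_slope_of_hasDerivAt left_mem_uIcc right_mem_uIcc hgt hd
    rw [slope_def_field, le_div_iff₀ (by linarith)] at a
    linarith

lemma pointwise_interior {I : Set ℝ} (hIc : Convex ℝ I) (h1 : (1 : ℝ) ∈ I)
    {f f' f'' : ℝ → ℝ}
    (hf : ∀ x ∈ I, HasDerivAt f (f' x) x) (hf' : ∀ x ∈ I, HasDerivAt f' (f'' x) x)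
    (hf1 : f 1 = 0) (hf1' : f' 1 = 0) (hpos : ∀ x ∈ I, 0 < f'' x) {a c : ℝ}
    (hc : ∀ x ∈ I, 1 / f'' x ≤ a + c * (x - 1)) {x : ℝ} (hx : x ∈ I)
    (hm : 0 < a + c * (x - 1) / 3) :
    (x - 1) ^ 2 ≤ 2 * (a + c * (x - 1) / 3) * f x := by
  obtain ⟨m, hmdef⟩ : ∃ m, m = a + c * (x - 1) / 3 := ⟨_, rfl⟩
  rw [← hmdef] at hm ⊢
  have hsub : uIcc 1 x ⊆ I := hIc.ordConnected.uIcc_subset h1 hx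
  have key := compare_of_second_deriv hIc h1 hf hf' hf1 hf1' hx
    (q := fun s => ((2 * m - a) * (s - 1) ^ 2 / 2 - c * (s - 1) ^ 3 / 6) / m ^ 2)
    (q' := fun s => ((2 * m - a) * (s - 1) - c * (s - 1) ^ 2 / 2) / m ^ 2)
    (q'' := fun s => ((2 * m - a) - c * (s - 1)) / m ^ 2) ?_ ?_ (by simp) (by simp) ?_
  · have e : ((2 * m - a) * (x - 1) ^ 2 / 2 - c * (x - 1) ^ 3 / 6) / m ^ 2
        = (x - 1) ^ 2 / (2 * m) := by
      have ha : a = m - c * (x - 1) / 3 := by linarith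
      rw [ha]
      field_simp
      ring
    simp only [e] at key
    rw [div_le_iff₀ (by positivity)] at key
    linarith
  · intro s _
    have hs : HasDerivAt (fun s : ℝ => s - 1) 1 s := (hasDerivAt_id s).sub_const 1
    have := ((((hs.pow 2).const_mul (2 * m - a)).div_const 2).sub
      (((hs.pow 3).const_mul c).div_const 6)).div_const (m ^ 2)
    refine this.congr_deriv ?_
    norm_num
    ring
  · intro s _
    have hs : HasDerivAt (fun s : ℝ => s - 1) 1 s := (hasDerivAt_id s).sub_const 1
    have := ((hs.const_mul (2 * m - a)).sub
      (((hs.pow 2).const_mul c).div_const 2)).div_const (m ^ 2)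
    refine this.congr_deriv ?_
    norm_num
    ring
  · intro s hs
    have hk := hpos s (hsub hs)
    have hl := hc s (hsub hs)
    rw [div_le_iff₀ (by positivity)]
    rw [div_le_iff₀ hk] at hl
    have : 0 ≤ (f'' s * m - 1) ^ 2 := sq_nonneg _
    by_contra hcon
    push Not at hcon
    nlinarith

lemma xlogx_bound {I : Set ℝ} (hIc : Convex ℝ I) (h1 : (1 : ℝ) ∈ I)
    {f f' f'' : ℝ → ℝ}
    (hf : ∀ x ∈ I, HasDerivAt f (f' x) x) (hf' : ∀ x ∈ I, HasDerivAt f' (f'' x) x)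
    (hf1 : f 1 = 0) (hf1' : f' 1 = 0) (hpos : ∀ x ∈ I, 0 < f'' x) {a c : ℝ}
    (hc : ∀ x ∈ I, 1 / f'' x ≤ a + c * (x - 1)) {A : ℝ} (hA : 0 < A) (haA : a ≤ A) (hcA : c ≤ A)
    {x : ℝ} (hx : x ∈ I) (hx1 : 1 ≤ x) :
    (x * Real.log x - x + 1) / A ≤ f x := by
  have hsub : uIcc 1 x ⊆ I := hIc.ordConnected.uIcc_subset h1 hx
  have hge : ∀ s ∈ uIcc 1 x, 1 ≤ s := by
    intro s hs
    rw [uIcc_of_le hx1] at hs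
    exact hs.1
  refine compare_of_second_deriv hIc h1 hf hf' hf1 hf1' hx
    (q := fun s => (s * Real.log s - s + 1) / A)
    (q' := fun s => Real.log s / A)
    (q'' := fun s => s⁻¹ / A) ?_ ?_ (by simp) (by simp) ?_
  · intro s hs
    have h0 : s ≠ 0 := by linarith [hge s hs]
    have := ((((hasDerivAt_id s).mul (Real.hasDerivAt_log h0)).sub (hasDerivAt_id s)).add_const
      (1 : ℝ)).div_const A
    refine this.congr_deriv ?_
    simp [h0]
  · intro s hs
    have h0 : s ≠ 0 := by linarith [hge s hs]
    exact (Real.hasDerivAt_log h0).div_const A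
  · intro s hs
    have h0 := hge s hs
    have hk := hpos s (hsub hs)
    have hl := hc s (hsub hs)
    have h2 : 1 / f'' s ≤ A * s := by nlinarith
    rw [div_le_iff₀ hk] at h2
    rw [div_le_iff₀ hA, inv_le_iff_one_le_mul₀ (by linarith)]
    linarith

/-- The final integral argument. -/
lemma integral_argument {Ω : Type*} [MeasurableSpace Ω] (φ : ℝ → ℝ≥0∞) (hφ : Measurable φ)
    {a b : ℝ} (ha : 0 < a)
    (hpt : ∀ x : ℝ, φ x ≠ ⊤ → 0 < a + b * (x - 1) ∧
      (x - 1) ^ 2 ≤ 2 * (a + b * (x - 1)) * (φ x).toReal)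
    (μ ν : Measure Ω) [IsProbabilityMeasure μ] [IsProbabilityMeasure ν] (hac : μ ≪ ν)
    (hfin : ∫⁻ ω, φ ((μ.rnDeriv ν ω).toReal) ∂ν ≠ ⊤) :
    ENNReal.ofReal (1 / a / 2 * tvDist μ ν ^ 2) ≤ ∫⁻ ω, φ ((μ.rnDeriv ν ω).toReal) ∂ν := by
  set r : Ω → ℝ := fun ω => (μ.rnDeriv ν ω).toReal with hr
  have hrm : Measurable r := (Measure.measurable_rnDeriv μ ν).ennreal_toReal
  have hri : Integrable r ν := Measure.integrable_toReal_rnDeriv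
  have hr1 : ∫ ω, r ω ∂ν = 1 := by
    have := integral_rnDeriv_smul hac (f := fun _ : Ω => (1 : ℝ))
    simpa using this
  have hφm : Measurable (fun ω => φ (r ω)) := hφ.comp hrm
  have hfi : Integrable (fun ω => (φ (r ω)).toReal) ν :=
    integrable_toReal_of_lintegral_ne_top hφm.aemeasurable hfin
  have hae : ∀ᵐ ω ∂ν, φ (r ω) < ⊤ := ae_lt_top hφm hfin
  have hint : ∫ ω, (φ (r ω)).toReal ∂ν = (∫⁻ ω, φ (r ω) ∂ν).toReal :=
    integral_toReal hφm.aemeasurable hae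
  have hr1i : Integrable (fun ω => r ω - 1) ν := hri.sub (integrable_const 1)
  set V := ∫ ω, |r ω - 1| ∂ν with hV
  have hV0 : 0 ≤ V := integral_nonneg fun ω => abs_nonneg _
  have hVD : V ^ 2 ≤ 2 * a * ∫ ω, (φ (r ω)).toReal ∂ν := by
    have hwi : Integrable (fun ω => a + b * (r ω - 1)) ν :=
      (integrable_const a).add (hr1i.const_mul b)
    have hmono : ∫ ω, (2 * V * |r ω - 1| - V ^ 2 / a * (a + b * (r ω - 1))) ∂ν
        ≤ ∫ ω, 2 * a * (φ (r ω)).toReal ∂ν := by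
      refine integral_mono_ae ?_ (hfi.const_mul _) ?_
      · exact (hr1i.abs.const_mul _).sub
          (hwi.const_mul _)
      · filter_upwards [hae] with ω hω
        obtain ⟨hw, hb⟩ := hpt (r ω) hω.ne
        show 2 * V * |r ω - 1| - V ^ 2 / a * (a + b * (r ω - 1)) ≤ 2 * a * (φ (r ω)).toReal
        generalize a + b * (r ω - 1) = w at hw hb ⊢
        generalize (φ (r ω)).toReal = p at hb ⊢
        rw [← sq_abs] at hb
        generalize |r ω - 1| = u at hb ⊢
        have h1 : u ^ 2 / w ≤ 2 * p := by
          rw [div_le_iff₀ hw]; linarith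
        have h2 : 2 * V * u - V ^ 2 / a * w ≤ a * (u ^ 2 / w) := by
          have : a * (u ^ 2 / w) - (2 * V * u - V ^ 2 / a * w) = (a * u - V * w) ^ 2 / (a * w) := by
            field_simp
            ring
          have h3 : 0 ≤ (a * u - V * w) ^ 2 / (a * w) := by positivity
          linarith
        nlinarith
    rw [integral_sub (hr1i.abs.const_mul _)
      (hwi.const_mul _), integral_const_mul,
      integral_const_mul, integral_const_mul,
      integral_add (integrable_const a) (hr1i.const_mul b), integral_const_mul,
      integral_sub hri (integrable_const 1), hr1] at hmono
    simp only [integral_const, probReal_univ, smul_eq_mul, one_mul, sub_self, mul_zero,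
      add_zero] at hmono
    rw [← hV, div_mul_cancel₀ _ ha.ne'] at hmono
    linarith
  have hTV : tvDist μ ν ≤ V := by
    refine Real.sSup_le ?_ hV0
    rintro _ ⟨g, hg, hgb, rfl⟩
    have hgμ : Integrable g μ := Integrable.of_bound hg.aestronglyMeasurable 1
      (Eventually.of_forall fun ω => by simpa using hgb ω)
    have hgν : Integrable g ν := Integrable.of_bound hg.aestronglyMeasurable 1
      (Eventually.of_forall fun ω => by simpa using hgb ω)
    have e1 : ∫ ω, g ω ∂μ = ∫ ω, r ω * g ω ∂ν := by
      rw [← integral_rnDeriv_smul hac]; rfl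
    have hrg : Integrable (fun ω => r ω * g ω) ν :=
      (integrable_toReal_rnDeriv_mul_iff hac).2 hgμ
    rw [e1, ← integral_sub hrg hgν]
    refine (abs_integral_le_integral_abs).trans ?_
    refine integral_mono (hrg.sub hgν).abs hr1i.abs fun ω => ?_
    show |r ω * g ω - g ω| ≤ |r ω - 1|
    rw [← sub_one_mul, abs_mul]
    exact mul_le_of_le_one_right (abs_nonneg _) (hgb ω)
  have hTV0 : 0 ≤ tvDist μ ν := by
    refine Real.sSup_nonneg ?_
    rintro _ ⟨g, hg, hgb, rfl⟩
    exact abs_nonneg _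
  refine ENNReal.ofReal_le_of_le_toReal ?_
  rw [← hint]
  have : tvDist μ ν ^ 2 ≤ V ^ 2 := by gcongr
  calc 1 / a / 2 * tvDist μ ν ^ 2 ≤ 1 / a / 2 * (2 * a * ∫ ω, (φ (r ω)).toReal ∂ν) := by
        gcongr; linarith
    _ = _ := by field_simp

/-- **An optimal Pinsker-type inequality under concavity of `1/φ''`.**  Suppose `φ` is
strictly convex on its domain, twice differentiable with `φ'' > 0` on the interior of the
domain, `1/φ''` concave on the interior of the domain, and `ψ*(x) → +∞` as
`x → φ'(∞)` from the left (which holds in particular whenever `φ'(∞) = +∞`).  Then for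
all probability measures `μ, ν`:  `D_φ(μ‖ν) ≥ (φ''(1)/2) · TV(μ,ν)²`. -/
theorem pinsker_of_concave_inv_second_derivative {Ω : Type*} [MeasurableSpace Ω]
    (φ : ℝ → ℝ≥0∞)
    (hconv : ∀ x y : ℝ, ∀ a b : ℝ≥0, a + b = 1 →
      φ ((a : ℝ) * x + (b : ℝ) * y) ≤ (a : ℝ≥0∞) * φ x + (b : ℝ≥0∞) * φ y)
    (hlsc : LowerSemicontinuous φ)
    (hneg : ∀ x : ℝ, x < 0 → φ x = ⊤)
    (hone : φ 1 = 0)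
    (hdom : (1 : ℝ) ∈ interior {x : ℝ | φ x ≠ ⊤})
    (dphi : ℝ≥0∞)
    (hdphi : Tendsto (fun x : ℝ => φ x / ENNReal.ofReal x) atTop (𝓝 dphi))
    (hstrict : StrictConvexOn ℝ {x : ℝ | φ x ≠ ⊤} (fun y : ℝ => (φ y).toReal))
    (dphi1 ddphi1 : ℝ → ℝ)
    (hd1 : ∀ x ∈ interior {x : ℝ | φ x ≠ ⊤},
      HasDerivAt (fun y : ℝ => (φ y).toReal) (dphi1 x) x)
    (hd2 : ∀ x ∈ interior {x : ℝ | φ x ≠ ⊤}, HasDerivAt dphi1 (ddphi1 x) x)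
    (hpos : ∀ x ∈ interior {x : ℝ | φ x ≠ ⊤}, 0 < ddphi1 x)
    (hconc : ConcaveOn ℝ (interior {x : ℝ | φ x ≠ ⊤}) (fun x : ℝ => 1 / ddphi1 x))
    (hblow : Tendsto (fun x : ℝ => psiStar φ x)
      (Filter.comap (fun x : ℝ => (x : EReal)) (𝓝[<] ((dphi : ℝ≥0∞) : EReal))) (𝓝 ⊤))
    (μ ν : Measure Ω) [IsProbabilityMeasure μ] [IsProbabilityMeasure ν] :
    ENNReal.ofReal (ddphi1 1 / 2 * tvDist μ ν ^ 2) ≤ divFull φ dphi μ ν := by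
  set S : Set ℝ := {x : ℝ | φ x ≠ ⊤} with hS
  set f : ℝ → ℝ := fun y => (φ y).toReal with hf
  have hSc : Convex ℝ S := hstrict.1
  have hIc : Convex ℝ (interior S) := hSc.interior
  have hf1 : f 1 = 0 := by simp [hf, hone]
  have hf1' : dphi1 1 = 0 := by
    refine IsLocalMin.hasDerivAt_eq_zero ?_ (hd1 1 hdom)
    refine Eventually.of_forall fun x => ?_
    rw [hf1]
    exact ENNReal.toReal_nonneg
  obtain ⟨c, hc⟩ := exists_supergradient isOpen_interior hdom hconc
  have ha : 0 < 1 / ddphi1 1 := by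
    have := hpos 1 hdom
    positivity
  set a := 1 / ddphi1 1 with hadef
  have hmix : ∀ x ∈ S, ∀ t : ℝ, 0 ≤ t → t < 1 → 1 + t * (x - 1) ∈ interior S := by
    intro x hx t h0 h1
    have := hSc.combo_interior_self_mem_interior hdom hx (a := 1 - t) (b := t) (by linarith) h0
      (by ring)
    simp only [smul_eq_mul] at this
    convert this using 1
    ring
  have hmpos : ∀ x ∈ S, 0 < a + c * (x - 1) / 3 := by
    intro x hx
    have h := hmix x hx (1 / 3) (by norm_num) (by norm_num)
    have h1 := hc _ h
    have h2 := hpos _ h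
    have h3 : 0 < 1 / ddphi1 (1 + 1 / 3 * (x - 1)) := by positivity
    have h4 : c * (1 + 1 / 3 * (x - 1) - 1) = c * (x - 1) / 3 := by ring
    linarith
  have hpt : ∀ x : ℝ, φ x ≠ ⊤ → 0 < a + c / 3 * (x - 1) ∧
      (x - 1) ^ 2 ≤ 2 * (a + c / 3 * (x - 1)) * (φ x).toReal := by
    intro x hx
    have hm := hmpos x hx
    have e : c / 3 * (x - 1) = c * (x - 1) / 3 := by ring
    rw [e]
    refine ⟨hm, ?_⟩
    have hev : ∀ t ∈ Ioo (0 : ℝ) 1, t * (x - 1) ^ 2 ≤ 2 * (a + c * (t * (x - 1)) / 3) * f x := by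
      intro t ht
      have hy := hmix x hx t ht.1.le ht.2
      have hmy := hmpos _ (interior_subset hy)
      have hb := pointwise_interior hIc hdom hd1 hd2 hf1 hf1' hpos hc hy hmy
      rw [add_sub_cancel_left] at hb hmy
      have hcv := hstrict.convexOn.2 (interior_subset hdom) hx
        (show (0 : ℝ) ≤ 1 - t by linarith [ht.2]) ht.1.le (by ring)
      have e2 : (1 - t) • (1 : ℝ) + t • x = 1 + t * (x - 1) := by
        simp only [smul_eq_mul]; ring
      rw [e2, hf1] at hcv
      simp only [smul_eq_mul, mul_zero, zero_add] at hcv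
      have h5 : (t * (x - 1)) ^ 2 ≤ 2 * (a + c * (t * (x - 1)) / 3) * (t * f x) :=
        hb.trans (by gcongr)
      have h6 : t * (t * (x - 1) ^ 2) ≤ t * (2 * (a + c * (t * (x - 1)) / 3) * f x) := by
        nlinarith
      exact le_of_mul_le_mul_left h6 ht.1
    have hl : Tendsto (fun t : ℝ => t * (x - 1) ^ 2) (𝓝[<] 1) (𝓝 (1 * (x - 1) ^ 2)) :=
      (Continuous.tendsto (by fun_prop) 1).mono_left nhdsWithin_le_nhds
    have hr : Tendsto (fun t : ℝ => 2 * (a + c * (t * (x - 1)) / 3) * f x) (𝓝[<] 1)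
        (𝓝 (2 * (a + c * (1 * (x - 1)) / 3) * f x)) :=
      (Continuous.tendsto (by fun_prop) 1).mono_left nhdsWithin_le_nhds
    have := le_of_tendsto_of_tendsto hl hr (by
      filter_upwards [Ioo_mem_nhdsLT (zero_lt_one' ℝ)] with t ht using hev t ht)
    simpa using this
  have htop : dphi = ⊤ := by
    by_contra hne
    -- the domain contains `[1, ∞)`
    have hev : ∀ᶠ x : ℝ in atTop, φ x / ENNReal.ofReal x < dphi + 1 :=
      hdphi.eventually_lt_const (ENNReal.lt_add_right hne one_ne_zero)
    set K := (dphi + 1).toReal with hK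
    have hKtop : dphi + 1 ≠ ⊤ := by simp [hne]
    have hev2 : ∀ᶠ x : ℝ in atTop, x ∈ S ∧ f x ≤ K * x := by
      filter_upwards [hev, eventually_gt_atTop 0] with x hx hx0
      have h1 : φ x ≤ (dphi + 1) * ENNReal.ofReal x :=
        (ENNReal.div_le_iff (by simpa using hx0) ENNReal.ofReal_ne_top).1 hx.le
      have h2 : (dphi + 1) * ENNReal.ofReal x ≠ ⊤ := ENNReal.mul_ne_top hKtop ENNReal.ofReal_ne_top
      refine ⟨ne_top_of_le_ne_top h2 h1, ?_⟩
      have := ENNReal.toReal_mono h2 h1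
      rwa [ENNReal.toReal_mul, ENNReal.toReal_ofReal hx0.le] at this
    have hI : ∀ x : ℝ, 1 ≤ x → x ∈ interior S := by
      intro x hx
      obtain ⟨y, hy, hyx⟩ := (hev2.and (eventually_gt_atTop x)).exists
      have := hmix y hy.1 ((x - 1) / (y - 1)) (div_nonneg (by linarith) (by linarith))
        (by rw [div_lt_one (by linarith)]; linarith)
      rwa [div_mul_cancel₀ _ (by linarith), add_sub_cancel] at this
    set A := max a c with hA
    have hA0 : 0 < A := lt_max_of_lt_left ha
    obtain ⟨x, hx, hx1, hxl⟩ := (hev2.and ((eventually_ge_atTop 1).and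
      (Real.tendsto_log_atTop.eventually_gt_atTop (A * K + 1)))).exists
    have hb := xlogx_bound hIc hdom hd1 hd2 hf1 hf1' hpos hc hA0 (le_max_left _ _)
      (le_max_right _ _) (hI x hx1) hx1
    have hb2 := hb.trans hx.2
    rw [div_le_iff₀ hA0] at hb2
    nlinarith
  unfold divFull
  by_cases hD : ∫⁻ ω, φ ((μ.rnDeriv ν ω).toReal) ∂ν = ⊤
  · rw [hD, top_add]; exact le_top
  by_cases hs : μ.singularPart ν Set.univ = 0
  · have hac : μ ≪ ν := by
      rw [← Measure.singularPart_eq_zero]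
      exact Measure.measure_univ_eq_zero.1 hs
    have := integral_argument φ hlsc.measurable ha hpt μ ν hac hD
    rw [hs, mul_zero, add_zero]
    simpa [hadef] using this
  · rw [htop, ENNReal.top_mul hs, add_top]; exact le_top
end
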